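/- arXiv:1812.08078 — 2 statements merged into one kernel-verified Lean document; each statement's English description precedes it below -/
import Mathlib

section
/- There exist absolute constants C, C' > 0 such that for all n ≥ 2, p ≥ 1, σ > 0, Δ > 0 with r_n ≥ C, every spectral estimator η⁰ satisfies sup_{(θ,η)∈Ω_Δ} (1/n) E_{(θ,η)}[ r(η⁰(Y), η) ] ≤ C'/r_n² + 32/n². -/
open MeasureTheory ProbabilityTheory Filter Finset Asymptotics
open scoped ENNReal

noncomputable section

/-- Euclidean norm on `Fin p → ℝ`. -/
def eucNorm {p : ℕ} (θ : Fin p → ℝ) : ℝ := Real.sqrt (∑ i, θ i ^ 2)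

/-- The set of label vectors in `{-1,1}^n`. -/
def pmOne (n : ℕ) : Set (Fin n → ℝ) := {η | ∀ i, η i = 1 ∨ η i = -1}

/-- `sgn s = 1` if `s ≥ 0` and `-1` otherwise. -/
def sgn (s : ℝ) : ℝ := if 0 ≤ s then 1 else -1

/-- Hamming-type loss `r(a,b) = min over ν ∈ {±1} of Σ_j |a_j - ν b_j|`. -/
def lossR {n : ℕ} (a b : Fin n → ℝ) : ℝ :=
  min (∑ j, |a j - b j|) (∑ j, |a j + b j|)

/-- Law of `Y = θ ηᵀ + W`, where `W` has i.i.d. `N(0,σ²)` entries. -/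
def lawY (p n : ℕ) (σ : ℝ) (θ : Fin p → ℝ) (η : Fin n → ℝ) :
    Measure (Fin p → Fin n → ℝ) :=
  Measure.pi fun i => Measure.pi fun j => gaussianReal (θ i * η j) (σ ^ 2).toNNReal

/-- Parameter set `Ω_Δ = {θ : ‖θ‖ ≥ Δ} × {-1,1}^n`. -/
def Omega (p n : ℕ) (Δ : ℝ) : Set ((Fin p → ℝ) × (Fin n → ℝ)) :=
  {x | Δ ≤ eucNorm x.1 ∧ x.2 ∈ pmOne n}

/-- Expected loss of an estimator `f` at `(θ, η)`. -/
def risk (p n : ℕ) (σ : ℝ) (f : (Fin p → Fin n → ℝ) → Fin n → ℝ)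
    (θ : Fin p → ℝ) (η : Fin n → ℝ) : ℝ :=
  ∫ y, lossR (f y) η ∂(lawY p n σ θ η)

/-- Minimax risk `Ψ_Δ`. -/
def minimaxRisk (p n : ℕ) (σ Δ : ℝ) : ℝ :=
  ⨅ f : {f : (Fin p → Fin n → ℝ) → Fin n → ℝ // Measurable f ∧ ∀ y, f y ∈ pmOne n},
    ⨆ x : Omega p n Δ, (n : ℝ)⁻¹ * risk p n σ f.1 x.1.1 x.1.2

/-- Standard Gaussian upper tail `Φᶜ(t) = P(Z > t)`. -/
def Phic (t : ℝ) : ℝ := ((gaussianReal 0 1) {x | t < x}).toReal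

/-- Signal-to-noise ratio `r_n = (Δ²/σ²)/√(Δ²/σ² + p/n)`. -/
def snr (p n : ℕ) (σ Δ : ℝ) : ℝ :=
  (Δ ^ 2 / σ ^ 2) / Real.sqrt (Δ ^ 2 / σ ^ 2 + (p : ℝ) / n)

/-- Gaussian product measure on `Fin p → ℝ` with i.i.d. centered coordinates of variance `v`. -/
def gaussVec (p : ℕ) (v : ℝ) : Measure (Fin p → ℝ) :=
  Measure.pi fun _ => gaussianReal 0 v.toNNReal

/-- `G_σ(t, θ) = P((θ + σξ₁)ᵀ(θ + (σ/(n-1)) Σ_{j=2}^n ξ_j) ≤ ‖θ‖² t)` for i.i.d.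
standard Gaussian vectors `ξ₁, …, ξ_n` in `ℝ^p`. -/
def Gfun (p n : ℕ) (σ t : ℝ) (θ : Fin p → ℝ) : ℝ :=
  (((gaussVec p 1).prod (Measure.pi fun _ : Fin (n - 1) => gaussVec p 1))
    {ξ | ∑ i, (θ i + σ * ξ.1 i) * (θ i + σ / ((n : ℝ) - 1) * ∑ j, ξ.2 j i)
        ≤ eucNorm θ ^ 2 * t}).toReal

/-- Hollowed Gram matrix `H(YᵀY)` of the observation `y`, as a function. -/
def hollowGram {p n : ℕ} (y : Fin p → Fin n → ℝ) : Fin n → Fin n → ℝ :=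
  fun a b => if a = b then 0 else ∑ i, y i a * y i b

/-- `v` is a unit-norm eigenvector of the matrix `M` for its largest eigenvalue. -/
def IsTopEigenvector {n : ℕ} (M : Fin n → Fin n → ℝ) (v : Fin n → ℝ) : Prop :=
  eucNorm v = 1 ∧ ∃ μ : ℝ, (∀ a, ∑ b, M a b * v b = μ * v a) ∧
    ∀ μ' : ℝ, (∃ w : Fin n → ℝ, w ≠ 0 ∧ ∀ a, ∑ b, M a b * w b = μ' * w a) → μ' ≤ μ

/-- A spectral estimator: the entrywise sign of a measurable selection of a unit-norm
top eigenvector of `H(YᵀY)`. -/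
def IsSpectralEstimator (p n : ℕ) (f : (Fin p → Fin n → ℝ) → Fin n → ℝ) : Prop :=
  Measurable f ∧ ∃ v : (Fin p → Fin n → ℝ) → Fin n → ℝ, Measurable v ∧
    (∀ y, IsTopEigenvector (hollowGram y) (v y)) ∧
    ∀ y a, f y a = sgn (v y a)

/-- Lloyd iterations `η̂^{k+1}(Y) = sign(H(YᵀY) η̂^k(Y))`, started from `f0`. -/
def lloydIter {p n : ℕ} (f0 : (Fin p → Fin n → ℝ) → Fin n → ℝ) :
    ℕ → (Fin p → Fin n → ℝ) → Fin n → ℝ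
  | 0 => f0
  | k + 1 => fun y a => sgn (∑ b, hollowGram y a b * lloydIter f0 k y b)

/-- Operator (spectral) norm of a real matrix with respect to Euclidean norms. -/
def opNorm {m n : ℕ} (M : Matrix (Fin m) (Fin n) ℝ) : ℝ :=
  ‖LinearMap.toContinuousLinearMap (Matrix.toEuclideanLin M)‖

/-- `H(M)`: the matrix `M` with its diagonal entries replaced by zero. -/
def hollow {n : ℕ} (M : Matrix (Fin n) (Fin n) ℝ) : Matrix (Fin n) (Fin n) ℝ :=
  Matrix.of fun a b => if a = b then 0 else M a b

/-- Gram matrix `WᵀW` of a `p × n` array `w`. -/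
def gramMat {p n : ℕ} (w : Fin p → Fin n → ℝ) : Matrix (Fin n) (Fin n) ℝ :=
  Matrix.of fun a b => ∑ i, w i a * w i b

/-- Law of a `p × n` random matrix with i.i.d. `N(0, τ²)` entries. -/
def lawW (p n : ℕ) (τ : ℝ) : Measure (Fin p → Fin n → ℝ) :=
  Measure.pi fun _ => Measure.pi fun _ => gaussianReal 0 (τ ^ 2).toNNReal

/-- Rademacher (uniform ±1) measure on `ℝ`. -/
def rademacher : Measure ℝ :=
  (2 : ℝ≥0∞)⁻¹ • Measure.dirac (1 : ℝ) + (2 : ℝ≥0∞)⁻¹ • Measure.dirac (-1 : ℝ)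

instance : IsProbabilityMeasure rademacher := by
  constructor
  simp [rademacher, Measure.add_apply, Measure.smul_apply, smul_eq_mul]
  rw [ENNReal.inv_two_add_inv_two]

/-- i.i.d. Rademacher vector measure on `Fin n → ℝ`. -/
def radVec (n : ℕ) : Measure (Fin n → ℝ) := Measure.pi fun _ => rademacher


lemma aux_lintegral_pi_prod {ι : Type*} [Fintype ι] {X : ι → Type*} [∀ i, MeasurableSpace (X i)]
    (μ : ∀ i, Measure (X i)) [∀ i, IsProbabilityMeasure (μ i)]
    (f : ∀ i, X i → ℝ≥0∞) (hf : ∀ i, Measurable (f i)) :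
    ∫⁻ x, ∏ i, f i (x i) ∂(Measure.pi μ) = ∏ i, ∫⁻ x, f i x ∂(μ i) := by
  have h := iIndepFun_pi (μ := μ) (X := f) (fun i => (hf i).aemeasurable)
  rw [lintegral_prod_eq_prod_lintegral_of_indepFun Finset.univ (fun i (x : ∀ i, X i) => f i (x i)) h
    (fun i => (hf i).comp (measurable_pi_apply i))]
  refine Finset.prod_congr rfl fun i _ => ?_
  rw [← lintegral_map (f := f i) (hf i) (measurable_pi_apply i)]
  rw [(measurePreserving_eval μ i).map_eq]

lemma aux_map_sum {n : ℕ} (m u : Fin n → ℝ) (v s : NNReal)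
    (hs : (s : ℝ) = (∑ j, u j ^ 2) * v) :
    (Measure.pi fun j => gaussianReal (m j) v).map (fun y => ∑ j, u j * y j)
      = gaussianReal (∑ j, u j * m j) s := by
  have h1 : (Measure.pi fun j => gaussianReal (m j) v).map (fun y => ∑ j, u j * y j)
     = ((Measure.pi fun j => gaussianReal (m j) v).map (fun y j => u j * y j)).map (fun y => ∑ j, y j) := by
    rw [Measure.map_map (by fun_prop) (by fun_prop)]
    rfl
  rw [h1, Measure.pi_map_pi (μ := fun j => gaussianReal (m j) v) (f := fun j x => u j * x)
    (fun i => by fun_prop)]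
  have h2 : ∀ j, (gaussianReal (m j) v).map (fun x => u j * x)
      = gaussianReal (u j * m j) (Real.toNNReal (u j ^ 2) * v) := by
    intro j
    rw [gaussianReal_map_const_mul]
    congr 2
    ext
    simp [sq_nonneg]
  simp_rw [h2]
  apply Measure.ext_of_charFun
  rw [charFun_map_sum_pi_eq_prod]
  ext t
  simp only [Finset.prod_apply, charFun_gaussianReal, ← Complex.exp_sum]
  congr 1
  rw [Finset.sum_sub_distrib]
  have hs' : ((s : ℝ) : ℂ) = (∑ j, (u j : ℂ) ^ 2) * ((v : ℝ) : ℂ) := by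
    rw [hs]; push_cast; rfl
  rw [hs']
  push_cast
  rw [Finset.mul_sum, Finset.sum_mul, Finset.sum_mul, Finset.sum_mul, Finset.sum_div]
  congr 1
  apply Finset.sum_congr rfl
  intro j _
  have : ((Real.toNNReal (u j ^ 2) : ℝ) : ℂ) = (u j : ℂ) ^ 2 := by
    rw [Real.coe_toNNReal _ (sq_nonneg _)]; push_cast; rfl
  rw [this]

lemma aux_exp {x : ℝ} (hx : |x| ≤ 1 / 2) : (Real.sqrt (1 - x))⁻¹ * Real.exp (-x / 2) ≤ Real.exp (x ^ 2) := by
  have h := Real.abs_log_sub_add_sum_range_le (x := x) (by linarith) 1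
  have hx' := abs_le.1 hx
  have hp : 0 < 1 - x := by linarith
  simp only [sum_range_one, zero_add, pow_one, Nat.cast_zero, div_one] at h
  have h2 : |x| ^ (1 + 1) / (1 - |x|) ≤ 2 * x ^ 2 := by
    rw [div_le_iff₀ (by linarith)]
    norm_num
    nlinarith [sq_nonneg x]
  have h3 := (abs_le.1 (h.trans h2)).1
  have h4 : (Real.sqrt (1 - x))⁻¹ = Real.exp (-(Real.log (1-x) / 2)) := by
    rw [Real.exp_neg, Real.sqrt_eq_rpow, Real.rpow_def_of_pos hp]
    congr 2
    ring
  rw [h4, ← Real.exp_add]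
  apply Real.exp_le_exp.2
  linarith

lemma aux_mgf (m l : ℝ) (v : NNReal) (hl : |l| * v ≤ 1 / 4) :
    ∫⁻ x, ENNReal.ofReal (Real.exp (l * (x ^ 2 - m ^ 2 - v))) ∂(gaussianReal m v)
      ≤ ENNReal.ofReal (Real.exp (4 * l ^ 2 * (v ^ 2 + m ^ 2 * v))) := by
  by_cases hv : v = 0
  · subst hv
    simp
  have hv0 : (0 : ℝ) < v := by positivity
  have hlv : |l * v| ≤ 1 / 4 := by rwa [abs_mul, abs_of_pos hv0]
  have hlv' := abs_le.1 hlv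
  have hb : 0 < 1 - 2 * l * v := by linarith
  set b := 1 - 2 * l * v with hbdef
  let v' : NNReal := ⟨v / b, by positivity⟩
  have hv' : v' ≠ 0 := by
    intro h
    have : (v : ℝ) / b = 0 := congrArg NNReal.toReal h
    have : 0 < (v : ℝ) / b := by positivity
    linarith
  set κ := (Real.sqrt b)⁻¹ * Real.exp (-(2*l*v)/2) * Real.exp (l * m ^ 2 / b - l * m ^ 2) with hκ
  have key : ∀ x, gaussianPDFReal m v x * Real.exp (l * (x ^ 2 - m ^ 2 - v))
      = κ * gaussianPDFReal (m / b) v' x := by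
    intro x
    simp only [gaussianPDFReal, hκ]
    have e1 : (v' : ℝ) = v / b := rfl
    rw [e1]
    have e2 : (Real.sqrt (2 * Real.pi * v))⁻¹ = (Real.sqrt b)⁻¹ * (Real.sqrt (2 * Real.pi * (v / b)))⁻¹ := by
      rw [← mul_inv, ← Real.sqrt_mul hb.le]
      congr 2
      field_simp
    rw [e2]
    have e3 : Real.exp (-(x - m) ^ 2 / (2 * v)) * Real.exp (l * (x ^ 2 - m ^ 2 - v)) =
       Real.exp (-(2*l*v)/2) * Real.exp (l * m ^ 2 / b - l * m ^ 2) * Real.exp (-(x - m / b) ^ 2 / (2 * (v / b))) := by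
      rw [← Real.exp_add, ← Real.exp_add, ← Real.exp_add]
      congr 1
      have : l = (1 - b) / (2 * v) := by rw [hbdef]; field_simp; ring
      rw [this]
      field_simp
      ring
    linear_combination (Real.sqrt b)⁻¹ * (Real.sqrt (2 * Real.pi * (v / b)))⁻¹ * e3
  rw [gaussianReal_of_var_ne_zero _ hv, lintegral_withDensity_eq_lintegral_mul _ (measurable_gaussianPDF m v) (by fun_prop)]
  have h1 : ∀ x, (gaussianPDF m v * fun x => ENNReal.ofReal (Real.exp (l * (x ^ 2 - m ^ 2 - v)))) x
     = ENNReal.ofReal κ * gaussianPDF (m/b) v' x := by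
    intro x
    simp only [Pi.mul_apply, gaussianPDF]
    rw [← ENNReal.ofReal_mul (gaussianPDFReal_nonneg _ _ _), key, ENNReal.ofReal_mul (by positivity)]
  simp_rw [h1]
  rw [lintegral_const_mul _ (measurable_gaussianPDF _ _), lintegral_gaussianPDF_eq_one _ hv', mul_one]
  apply ENNReal.ofReal_le_ofReal
  have h2 : l * m ^ 2 / b - l * m ^ 2 ≤ 4 * l ^ 2 * (m ^ 2 * v) := by
    have : l * m ^ 2 / b - l * m ^ 2 = 2 * l ^ 2 * (m ^ 2 * v) / b := by
      field_simp
      rw [hbdef]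
      ring
    rw [this, div_le_iff₀ hb]
    have : 0 ≤ l ^ 2 * (m ^ 2 * v) := by positivity
    nlinarith
  have h3 := aux_exp (x := 2 * l * v) (by rw [mul_assoc, abs_mul]; norm_num; linarith)
  calc κ ≤ Real.exp ((2 * l * v) ^ 2) * Real.exp (4 * l ^ 2 * (m ^ 2 * v)) := by
        apply mul_le_mul h3 (Real.exp_le_exp.2 h2) (by positivity) (by positivity)
    _ = _ := by
        rw [← Real.exp_add]; congr 1; ring

/-- The centred quadratic form of the Gram matrix. -/
def auxQ {p n : ℕ} (σ : ℝ) (θ : Fin p → ℝ) (η : Fin n → ℝ) (y : Fin p → Fin n → ℝ)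
    (u : Fin n → ℝ) : ℝ :=
  (∑ i, (∑ j, u j * y i j) ^ 2) - (∑ i, θ i ^ 2) * (∑ j, u j * η j) ^ 2 - p * (σ ^ 2 * ∑ j, u j ^ 2)

lemma aux_mgfY {p n : ℕ} (σ : ℝ) (θ : Fin p → ℝ) (η : Fin n → ℝ) (u : Fin n → ℝ) (l : ℝ)
    (hl : |l| * (σ ^ 2 * ∑ j, u j ^ 2) ≤ 1 / 4) :
    ∫⁻ y, ENNReal.ofReal (Real.exp (l * auxQ σ θ η y u)) ∂(lawY p n σ θ η) ≤
      ENNReal.ofReal (Real.exp (4 * l ^ 2 * (p * (σ ^ 2 * ∑ j, u j ^ 2) ^ 2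
        + (∑ i, θ i ^ 2) * (∑ j, u j * η j) ^ 2 * (σ ^ 2 * ∑ j, u j ^ 2)))) := by
  set c := ∑ j, u j * η j with hc
  have hs0 : 0 ≤ σ ^ 2 * ∑ j, u j ^ 2 := by positivity
  set s : NNReal := Real.toNNReal (σ ^ 2 * ∑ j, u j ^ 2) with hs
  have hsr : (s : ℝ) = σ ^ 2 * ∑ j, u j ^ 2 := Real.coe_toNNReal _ hs0
  have h1 : ∀ y : Fin p → Fin n → ℝ, ENNReal.ofReal (Real.exp (l * auxQ σ θ η y u)) =
      ∏ i, (fun z : Fin n → ℝ => ENNReal.ofReal (Real.exp (l * ((∑ j, u j * z j) ^ 2 - (θ i * c) ^ 2 - s)))) (y i) := by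
    intro y
    rw [← ENNReal.ofReal_prod_of_nonneg (fun i _ => (Real.exp_pos _).le), ← Real.exp_sum]
    congr 2
    rw [← Finset.mul_sum, Finset.sum_sub_distrib, Finset.sum_sub_distrib]
    simp only [auxQ, hsr, mul_pow, ← Finset.sum_mul, Finset.sum_const, Finset.card_univ, Fintype.card_fin, nsmul_eq_mul, ← hc]
    ring
  simp_rw [h1]
  rw [lawY, aux_lintegral_pi_prod _ (fun (i : Fin p) (z : Fin n → ℝ) => ENNReal.ofReal (Real.exp (l * ((∑ j, u j * z j) ^ 2 - (θ i * c) ^ 2 - s))))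
    (fun i => by fun_prop)]
  have h2 : ∀ i, ∫⁻ z, ENNReal.ofReal (Real.exp (l * ((∑ j, u j * z j) ^ 2 - (θ i * c) ^ 2 - s)))
      ∂(Measure.pi fun j => gaussianReal (θ i * η j) (σ ^ 2).toNNReal) ≤
      ENNReal.ofReal (Real.exp (4 * l ^ 2 * (s ^ 2 + (θ i * c) ^ 2 * s))) := by
    intro i
    have hm := aux_map_sum (fun j => θ i * η j) u (σ ^ 2).toNNReal s (by
      rw [hsr, Real.coe_toNNReal _ (sq_nonneg _), mul_comm])
    have hmm : ∑ j, u j * (θ i * η j) = θ i * c := by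
      rw [hc, Finset.mul_sum]; apply Finset.sum_congr rfl; intros; ring
    rw [hmm] at hm
    have h3 := aux_mgf (θ i * c) l s (by rw [hsr]; exact hl)
    rw [← hm, lintegral_map (by fun_prop) (by fun_prop)] at h3
    exact h3
  refine (Finset.prod_le_prod' fun i _ => h2 i).trans ?_
  rw [← ENNReal.ofReal_prod_of_nonneg (fun i _ => (Real.exp_pos _).le), ← Real.exp_sum]
  apply le_of_eq
  congr 2
  rw [← Finset.mul_sum, Finset.sum_add_distrib, ← Finset.sum_mul]
  simp only [hsr, mul_pow, ← Finset.sum_mul, Finset.sum_const, Finset.card_univ, Fintype.card_fin, nsmul_eq_mul]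
  ring

section abs
variable {E : Type*} [NormedAddCommGroup E] [InnerProductSpace ℝ E]

lemma aux_polar (T : E →ₗ[ℝ] E) (hT : T.IsSymmetric) (K : ℝ)
    (hK : ∀ x, |inner ℝ (T x) x| ≤ K * ‖x‖ ^ 2) (x y : E) :
    |inner ℝ (T x) y| ≤ K * ‖x‖ * ‖y‖ := by
  have h : ∀ x y : E, 2 * |inner ℝ (T x) y| ≤ K * (‖x‖ ^ 2 + ‖y‖ ^ 2) := by
    intro x y
    have e1 : inner ℝ (T (x + y)) (x + y) - inner ℝ (T (x - y)) (x - y) = 4 * inner ℝ (T x) y := by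
      have := hT y x
      rw [real_inner_comm] at this
      simp only [map_add, map_sub, inner_add_left, inner_add_right, inner_sub_left, inner_sub_right]
      rw [hT y x, real_inner_comm (T x) y]
      ring
    have h1 := hK (x + y)
    have h2 := hK (x - y)
    have h3 : ‖x + y‖ ^ 2 + ‖x - y‖ ^ 2 = 2 * (‖x‖ ^ 2 + ‖y‖ ^ 2) := by
      have := parallelogram_law_with_norm ℝ x y
      nlinarith
    have h4 := abs_sub (inner ℝ (T (x + y)) (x + y)) (inner ℝ (T (x - y)) (x - y))
    rw [e1, abs_mul, abs_of_pos (by norm_num : (0:ℝ) < 4)] at h4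
    have h5 : K * ‖x + y‖ ^ 2 + K * ‖x - y‖ ^ 2 = K * (2 * (‖x‖ ^ 2 + ‖y‖ ^ 2)) := by rw [← h3]; ring
    linarith
  by_cases hx : x = 0
  · simp [hx]
  by_cases hy : y = 0
  · simp [hy]
  have hx' : 0 < ‖x‖ := norm_pos_iff.2 hx
  have hy' : 0 < ‖y‖ := norm_pos_iff.2 hy
  have h1 := h (‖y‖ • x) (‖x‖ • y)
  simp only [map_smul, inner_smul_left, inner_smul_right, norm_smul, norm_norm, abs_mul, abs_norm, conj_trivial] at h1
  have : ‖y‖ * ‖x‖ * |inner ℝ (T x) y| ≤ ‖y‖ * ‖x‖ * (K * ‖x‖ * ‖y‖) := by nlinarith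
  exact le_of_mul_le_mul_left this (by positivity)

lemma aux_dk (T : E →ₗ[ℝ] E) (hT : T.IsSymmetric) (K g : ℝ) (hg : 0 ≤ g)
    (hK : ∀ x, |inner ℝ (T x) x| ≤ K * ‖x‖ ^ 2) (u v : E) (hu : ‖u‖ = 1) (hv : ‖v‖ = 1)
    (h : g * inner ℝ u u ^ 2 + inner ℝ (T u) u ≤ g * inner ℝ u v ^ 2 + inner ℝ (T v) v) :
    g ^ 2 * min (‖v - u‖ ^ 2) (‖v + u‖ ^ 2) ≤ 8 * K ^ 2 := by
  have hp := aux_polar T hT K hK (v - u) (v + u)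
  have e1 : inner ℝ (T (v - u)) (v + u) = inner ℝ (T v) v - inner ℝ (T u) u := by
    simp only [map_sub, inner_add_right, inner_sub_left]
    rw [hT v u, real_inner_comm (T u) v]
    ring
  have n1 : ‖v - u‖ ^ 2 = 2 - 2 * inner ℝ u v := by
    rw [norm_sub_sq_real, hu, hv, real_inner_comm]; ring
  have n2 : ‖v + u‖ ^ 2 = 2 + 2 * inner ℝ u v := by
    rw [norm_add_sq_real, hu, hv, real_inner_comm]; ring
  have hc : |inner ℝ u v| ≤ 1 := by simpa [hu, hv] using abs_real_inner_le_norm u v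
  rw [real_inner_self_eq_norm_sq, hu] at h
  set c : ℝ := inner ℝ u v
  have hc2 : c ^ 2 ≤ 1 := by rw [← sq_abs]; nlinarith [abs_nonneg c]
  have h1 : g * (1 - c ^ 2) ≤ K * ‖v - u‖ * ‖v + u‖ := by
    have := le_abs_self (inner ℝ (T (v - u)) (v + u))
    rw [e1] at this hp
    linarith
  have h2 : (g * (1 - c ^ 2)) ^ 2 ≤ (K * ‖v - u‖ * ‖v + u‖) ^ 2 :=
    pow_le_pow_left₀ (mul_nonneg hg (by linarith)) h1 2
  have h3 : (K * ‖v - u‖ * ‖v + u‖) ^ 2 = 4 * K ^ 2 * (1 - c ^ 2) := by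
    rw [mul_pow, mul_pow, n1, n2]; ring
  have h4 : g ^ 2 * (1 - c ^ 2) ≤ 4 * K ^ 2 := by
    rcases eq_or_lt_of_le (sub_nonneg.2 hc2) with h0 | h0
    · rw [← h0]; nlinarith [sq_nonneg K]
    · rw [h3] at h2
      have : (1 - c ^ 2) * (g ^ 2 * (1 - c ^ 2)) ≤ (1 - c ^ 2) * (4 * K ^ 2) := by nlinarith
      exact le_of_mul_le_mul_left this h0
  have h5 : min (‖v - u‖ ^ 2) (‖v + u‖ ^ 2) ≤ 2 * (1 - c ^ 2) := by
    rw [n1, n2]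
    have := abs_le.1 hc
    rcases le_total 0 c with h0 | h0
    · exact (min_le_left _ _).trans (by nlinarith)
    · exact (min_le_right _ _).trans (by nlinarith)
  nlinarith [mul_le_mul_of_nonneg_left h5 (sq_nonneg g)]

lemma aux_net [FiniteDimensional ℝ E] [Nontrivial E] [MeasurableSpace E] [BorelSpace E]
    (μ : Measure E) [μ.IsAddHaarMeasure]
    (T : E →ₗ[ℝ] E) (hT : T.IsSymmetric) :
    ∃ K : ℝ, 0 ≤ K ∧ (∀ x, |inner ℝ (T x) x| ≤ K * ‖x‖ ^ 2) ∧ ∀ l : ℝ, 0 ≤ l →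
      ENNReal.ofReal (Real.exp (2 / 5 * l * K)) * μ (Metric.ball 0 (1 / 4)) ≤
        ∫⁻ u in Metric.ball (0 : E) (5 / 4), (ENNReal.ofReal (Real.exp (l * inner ℝ (T u) u)) +
          ENNReal.ofReal (Real.exp (-l * inner ℝ (T u) u))) ∂μ := by
  have hcont : Continuous fun x => |inner ℝ (T x) x| := by
    have := T.continuous_of_finiteDimensional
    fun_prop
  obtain ⟨x₀, hx₀⟩ := NormedSpace.sphere_nonempty (x := (0:E)) (r := 1) |>.2 zero_le_one
  obtain ⟨u₀, hu₀, hmax⟩ := (isCompact_sphere (0 : E) 1).exists_isMaxOn ⟨x₀, hx₀⟩ hcont.continuousOn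
  have hu1 : ‖u₀‖ = 1 := by simpa using hu₀
  have hbd : ∀ x, |inner ℝ (T x) x| ≤ |inner ℝ (T u₀) u₀| * ‖x‖ ^ 2 := by
    intro x
    by_cases hx : x = 0
    · simp [hx]
    have hx' : 0 < ‖x‖ := norm_pos_iff.2 hx
    have h1 := hmax (show (‖x‖⁻¹ • x) ∈ Metric.sphere (0:E) 1 by simp [norm_smul, hx])
    simp only [Set.mem_ofPred_eq, map_smul, inner_smul_left, inner_smul_right, abs_mul, conj_trivial, abs_inv, abs_norm] at h1
    have : ‖x‖ ^ 2 * (‖x‖⁻¹ * (‖x‖⁻¹ * |inner ℝ (T x) x|)) ≤ ‖x‖ ^ 2 * |inner ℝ (T u₀) u₀| := by gcongr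
    calc _ = ‖x‖ ^ 2 * (‖x‖⁻¹ * (‖x‖⁻¹ * |inner ℝ (T x) x|)) := by field_simp
      _ ≤ _ := by linarith
  refine ⟨|inner ℝ (T u₀) u₀|, abs_nonneg _, hbd, ?_⟩
  intro l hl
  set K := |inner ℝ (T u₀) u₀| with hKdef
  have hK0 : 0 ≤ K := abs_nonneg _
  rw [← Measure.addHaar_ball_center μ u₀, ← setLIntegral_const]
  refine (setLIntegral_mono' measurableSet_ball ?_).trans
    (lintegral_mono_set (s := Metric.ball u₀ (1 / 4)) ?_)
  · intro u hu
    set h := u - u₀ with hh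
    have hu' : ‖h‖ ≤ 1 / 4 := by
      rw [Metric.mem_ball, dist_eq_norm] at hu
      exact hu.le
    have hu2 : u = u₀ + h := by rw [hh]; abel
    have e1 : inner ℝ (T u) u = inner ℝ (T u₀) u₀ + (2 * inner ℝ (T u₀) h + inner ℝ (T h) h) := by
      rw [hu2]
      simp only [map_add, inner_add_left, inner_add_right]
      rw [hT h u₀, real_inner_comm (T u₀) h]
      ring
    have h1 := aux_polar T hT K hbd u₀ h
    have h2 := hbd h
    rw [hu1] at h1
    have h3 : K ≤ |inner ℝ (T u) u| + (2 * |inner ℝ (T u₀) h| + |inner ℝ (T h) h|) := by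
      have a1 := abs_add_le (inner ℝ (T u) u) (-(2 * inner ℝ (T u₀) h + inner ℝ (T h) h))
      have a2 := abs_add_le (2 * inner ℝ (T u₀) h) (inner ℝ (T h) h)
      rw [abs_neg] at a1
      rw [abs_mul, abs_of_pos (by norm_num : (0:ℝ) < 2)] at a2
      have a3 : inner ℝ (T u) u + -(2 * inner ℝ (T u₀) h + inner ℝ (T h) h) = inner ℝ (T u₀) u₀ := by
        rw [e1]; ring
      rw [a3] at a1
      linarith
    have h4 : K * ‖h‖ ≤ K * (1 / 4) := by gcongr
    have h5 : K * ‖h‖ ^ 2 ≤ K * (1 / 4) ^ 2 := by gcongr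
    have h6 : 2 / 5 * K ≤ |inner ℝ (T u) u| := by nlinarith
    rw [← ENNReal.ofReal_add (Real.exp_pos _).le (Real.exp_pos _).le]
    apply ENNReal.ofReal_le_ofReal
    have h7 : 2 / 5 * l * K ≤ l * |inner ℝ (T u) u| := by nlinarith
    rcases abs_cases (inner ℝ (T u) u) with ⟨h8, _⟩ | ⟨h8, _⟩
    · rw [h8] at h7
      have := Real.exp_le_exp.2 h7
      linarith [Real.exp_pos (-l * inner ℝ (T u) u)]
    · rw [h8, mul_neg, ← neg_mul] at h7
      have := Real.exp_le_exp.2 h7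
      linarith [Real.exp_pos (l * inner ℝ (T u) u)]
  · apply Metric.ball_subset_ball'
    rw [dist_zero_right, hu1]
    norm_num
end abs

lemma aux_inner {n : ℕ} (A : Matrix (Fin n) (Fin n) ℝ) (x : EuclideanSpace ℝ (Fin n)) :
    inner ℝ (Matrix.toEuclideanLin A x) x = ∑ a, (∑ b, A a b * x b) * x a := by
  simp only [PiLp.inner_apply, Matrix.ofLp_toEuclideanLin_apply, Matrix.mulVec, dotProduct]
  apply Finset.sum_congr rfl
  intro a _
  simp [mul_comm]

/-- The noise part of the Gram matrix. -/
def auxM {p n : ℕ} (σ : ℝ) (θ : Fin p → ℝ) (η : Fin n → ℝ) (y : Fin p → Fin n → ℝ) :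
    Matrix (Fin n) (Fin n) ℝ :=
  Matrix.of fun a b => (∑ i, y i a * y i b) - (∑ i, θ i ^ 2) * (η a * η b)
    - if a = b then p * σ ^ 2 else 0

lemma aux_sum_sq {n : ℕ} (c x : Fin n → ℝ) :
    ∑ a, (∑ b, (c a * c b) * x b) * x a = (∑ b, x b * c b) ^ 2 := by
  rw [sq, Finset.sum_mul]
  apply Finset.sum_congr rfl
  intro a _
  rw [Finset.sum_mul, Finset.mul_sum]
  apply Finset.sum_congr rfl
  intro b _
  ring

lemma aux_innerM {p n : ℕ} (σ : ℝ) (θ : Fin p → ℝ) (η : Fin n → ℝ) (y : Fin p → Fin n → ℝ)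
    (x : EuclideanSpace ℝ (Fin n)) :
    inner ℝ (Matrix.toEuclideanLin (auxM σ θ η y) x) x = auxQ σ θ η y x := by
  rw [aux_inner]
  simp only [auxM, auxQ, Matrix.of_apply, sub_mul, Finset.sum_sub_distrib]
  congr 1
  · congr 1
    · simp_rw [← aux_sum_sq (fun j => y _ j)]
      rw [Finset.sum_comm]
      apply Finset.sum_congr rfl
      intro a _
      rw [← Finset.sum_mul, Finset.sum_comm]
      congr 1
      apply Finset.sum_congr rfl
      intro b _
      rw [Finset.sum_mul]
    · rw [← aux_sum_sq η, Finset.mul_sum]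
      apply Finset.sum_congr rfl
      intro a _
      rw [← mul_assoc, Finset.mul_sum]
      congr 1
      apply Finset.sum_congr rfl
      intro b _
      ring
  · simp only [ite_mul, zero_mul, Finset.sum_ite_eq, Finset.mem_univ, if_true]
    rw [← mul_assoc, Finset.mul_sum]
    apply Finset.sum_congr rfl
    intro a _
    ring

lemma aux_loss {n : ℕ} (hn : 0 < n) (v u : EuclideanSpace ℝ (Fin n)) (η : Fin n → ℝ)
    (hη : η ∈ pmOne n) (hu : ∀ j, Real.sqrt n * u j = η j) :
    lossR (fun j => sgn (v j)) η ≤ 2 * n * min (‖v - u‖ ^ 2) (‖v + u‖ ^ 2) := by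
  have hn' : (0:ℝ) ≤ n := by positivity
  have hs : Real.sqrt n ^ 2 = n := Real.sq_sqrt hn'
  have hs0 : 0 < Real.sqrt n := by positivity
  unfold lossR
  rw [mul_min_of_nonneg _ _ (by positivity : (0:ℝ) ≤ 2 * n)]
  apply min_le_min
  · rw [EuclideanSpace.norm_sq_eq, Finset.mul_sum]
    apply Finset.sum_le_sum
    intro j _
    have h1 : 2 * n * ‖(v - u) j‖ ^ 2 = 2 * (Real.sqrt n * v j - η j) ^ 2 := by
      rw [← hu j]; simp; linear_combination (-(2 * (v j - u j)^2)) * hs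
    rw [h1]
    unfold sgn
    beta_reduce
    rcases hη j with h | h <;> rw [h] <;> split_ifs with hv
    · simp; positivity
    · have : Real.sqrt n * v j ≤ 0 := by nlinarith
      norm_num
      rw [le_abs]
      first | (left; linarith) | (right; linarith)
    · have : 0 ≤ Real.sqrt n * v j := by positivity
      norm_num
      rw [le_abs]
      first | (left; linarith) | (right; linarith)
    · simp; positivity
  · rw [EuclideanSpace.norm_sq_eq, Finset.mul_sum]
    apply Finset.sum_le_sum
    intro j _
    have h1 : 2 * n * ‖(v + u) j‖ ^ 2 = 2 * (Real.sqrt n * v j + η j) ^ 2 := by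
      rw [← hu j]; simp; linear_combination (-(2 * (v j + u j)^2)) * hs
    rw [h1]
    unfold sgn
    beta_reduce
    rcases hη j with h | h <;> rw [h] <;> split_ifs with hv
    · have : 0 ≤ Real.sqrt n * v j := by positivity
      norm_num
      rw [le_abs]
      first | (left; linarith) | (right; linarith)
    · simp; positivity
    · simp; positivity
    · have : Real.sqrt n * v j ≤ 0 := by nlinarith
      norm_num
      rw [le_abs]
      first | (left; linarith) | (right; linarith)

lemma aux_top {n : ℕ} (hn : 0 < n) (A : Matrix (Fin n) (Fin n) ℝ) (hA : A.IsHermitian)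
    (v u : EuclideanSpace ℝ (Fin n)) (hv : IsTopEigenvector (fun a b => A a b) v) (hu : ‖u‖ = 1) :
    inner ℝ (Matrix.toEuclideanLin A u) u ≤ inner ℝ (Matrix.toEuclideanLin A v) v := by
  have : Nonempty (Fin n) := ⟨⟨0, hn⟩⟩
  obtain ⟨hv1, μ, hμ, hmax⟩ := hv
  have hT : (Matrix.toEuclideanLin A).IsSymmetric := Matrix.isSymmetric_toEuclideanLin_iff.2 hA
  have h1 : inner ℝ (Matrix.toEuclideanLin A v) v = μ := by
    rw [aux_inner]
    have : ∀ a, (∑ b, A a b * v b) * v a = μ * v a ^ 2 := by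
      intro a; rw [hμ a]; ring
    simp_rw [this]
    rw [← Finset.mul_sum]
    have h2 : ∑ i, v i ^ 2 = 1 := by
      unfold eucNorm at hv1
      rwa [Real.sqrt_eq_one] at hv1
    rw [h2, mul_one]
  rw [h1]
  have h2 := hT.hasEigenvalue_iSup_of_finiteDimensional
  obtain ⟨w, hw⟩ := h2.exists_hasEigenvector
  obtain ⟨K, hK0, hK, _⟩ := aux_net volume (Matrix.toEuclideanLin A) hT
  have h3 := hmax _ ⟨w, fun h => hw.2 (by ext i; simpa using congrFun h i), fun a => by
    have := congrArg (fun z : EuclideanSpace ℝ (Fin n) => z a) hw.apply_eq_smul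
    simpa [Matrix.ofLp_toEuclideanLin_apply, Matrix.mulVec, dotProduct] using this⟩
  refine le_trans ?_ h3
  have hu0 : u ≠ 0 := by
    intro h; simp [h] at hu
  refine le_trans ?_ (le_ciSup (f := fun x : { x : EuclideanSpace ℝ (Fin n) // x ≠ 0 } =>
    (RCLike.re (inner ℝ (Matrix.toEuclideanLin A x) (x : EuclideanSpace ℝ (Fin n))) / ‖(x : EuclideanSpace ℝ (Fin n))‖ ^ 2 : ℝ)) ?_ ⟨u, hu0⟩)
  · simp [hu]
  · refine ⟨K, ?_⟩
    rintro _ ⟨x, rfl⟩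
    have hx : 0 < ‖(x : EuclideanSpace ℝ (Fin n))‖ := norm_pos_iff.2 x.2
    simp only [RCLike.re_to_real]
    rw [div_le_iff₀ (by positivity)]
    exact (le_abs_self _).trans (hK x)

lemma aux_det {p n : ℕ} (hn : 0 < n) (σ : ℝ) (θ : Fin p → ℝ) (η : Fin n → ℝ) (hη : η ∈ pmOne n)
    (y : Fin p → Fin n → ℝ) (v : Fin n → ℝ) (hv : IsTopEigenvector (hollowGram y) v) :
    ∃ K : ℝ, 0 ≤ K ∧
      (n * ∑ i, θ i ^ 2) ^ 2 * lossR (fun j => sgn (v j)) η ≤ 64 * n * K ^ 2 ∧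
      ∀ l : ℝ, 0 ≤ l →
      ENNReal.ofReal (Real.exp (2 / 5 * l * K)) *
          volume (Metric.ball (0 : EuclideanSpace ℝ (Fin n)) (1 / 4)) ≤
        ∫⁻ u in Metric.ball (0 : EuclideanSpace ℝ (Fin n)) (5 / 4),
          (ENNReal.ofReal (Real.exp (l * auxQ σ θ η y u)) +
          ENNReal.ofReal (Real.exp (-l * auxQ σ θ η y u))) := by
  have : Nonempty (Fin n) := ⟨⟨0, hn⟩⟩
  set M := auxM σ θ η y with hM
  have hMsym : M.IsHermitian := by
    ext a b
    simp only [hM, auxM, Matrix.conjTranspose_apply, Matrix.of_apply, star_trivial, mul_comm, eq_comm]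
  obtain ⟨K, hK0, hK, hnet⟩ := aux_net volume (Matrix.toEuclideanLin M)
    (Matrix.isSymmetric_toEuclideanLin_iff.2 hMsym)
  refine ⟨K, hK0, ?_, ?_⟩
  swap
  · intro l hl
    simpa only [hM, aux_innerM] using hnet l hl
  -- hollowed noise
  let N : Matrix (Fin n) (Fin n) ℝ := Matrix.of fun a b => if a = b then 0 else M a b
  have hNsym : N.IsHermitian := by
    ext a b
    simp only [N, Matrix.conjTranspose_apply, Matrix.of_apply, star_trivial]
    by_cases h : a = b
    · simp [h]
    · rw [if_neg h, if_neg (Ne.symm h)]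
      simpa using hMsym.apply a b
  have hNT : (Matrix.toEuclideanLin N).IsSymmetric := Matrix.isSymmetric_toEuclideanLin_iff.2 hNsym
  have hdiag : ∀ a, |M a a| ≤ K := by
    intro a
    have := hK (EuclideanSpace.single a 1)
    rw [aux_inner] at this
    simpa [PiLp.single_apply] using this
  have hNin : ∀ x, inner ℝ (Matrix.toEuclideanLin N x) x = inner ℝ (Matrix.toEuclideanLin M x) x
      - ∑ a, M a a * x a ^ 2 := by
    intro x
    rw [aux_inner, aux_inner, ← Finset.sum_sub_distrib]
    apply Finset.sum_congr rfl
    intro a _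
    have : ∑ b, N a b * x b = ∑ b, M a b * x b - M a a * x a := by
      rw [eq_sub_iff_add_eq, ← Finset.add_sum_erase _ _ (Finset.mem_univ a),
        ← Finset.add_sum_erase _ (fun b => M a b * x b) (Finset.mem_univ a)]
      have : ∑ b ∈ univ.erase a, N a b * x b = ∑ b ∈ univ.erase a, M a b * x b := by
        apply Finset.sum_congr rfl
        intro b hb
        simp [N, (Finset.ne_of_mem_erase hb).symm]
      rw [this]
      simp [N]
    rw [this]; ring
  have hNK : ∀ x, |inner ℝ (Matrix.toEuclideanLin N x) x| ≤ (2 * K) * ‖x‖ ^ 2 := by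
    intro x
    rw [hNin]
    have h1 := hK x
    have h2 : |∑ a, M a a * x a ^ 2| ≤ K * ‖x‖ ^ 2 := by
      rw [EuclideanSpace.norm_sq_eq, Finset.mul_sum]
      refine (Finset.abs_sum_le_sum_abs _ _).trans (Finset.sum_le_sum fun a _ => ?_)
      rw [abs_mul, abs_of_nonneg (sq_nonneg (x a)), Real.norm_eq_abs, sq_abs]
      exact mul_le_mul_of_nonneg_right (hdiag a) (sq_nonneg _)
    have h3 := abs_sub (inner ℝ (Matrix.toEuclideanLin M x) x) (∑ a, M a a * x a ^ 2)
    linarith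
  have hη2 : ∀ a, η a * η a = 1 := by
    intro a; rcases hη a with h | h <;> rw [h] <;> norm_num
  set t := ∑ i, θ i ^ 2 with ht
  have ht0 : 0 ≤ t := by positivity
  let A : Matrix (Fin n) (Fin n) ℝ := Matrix.of (hollowGram y)
  have hAsym : A.IsHermitian := by
    ext a b
    simp only [A, hollowGram, Matrix.conjTranspose_apply, Matrix.of_apply, star_trivial, mul_comm, eq_comm]
  have hA : ∀ a b, A a b = t * (η a * η b) - (if a = b then t else 0) + N a b := by
    intro a b
    simp only [A, N, hM, auxM, hollowGram, Matrix.of_apply]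
    by_cases h : a = b
    · subst h; simp [hη2]
    · simp [h, ht]
  have hAin : ∀ x, inner ℝ (Matrix.toEuclideanLin A x) x = t * (∑ b, x b * η b) ^ 2 - t * ‖x‖ ^ 2
      + inner ℝ (Matrix.toEuclideanLin N x) x := by
    intro x
    rw [aux_inner, aux_inner, ← aux_sum_sq, EuclideanSpace.norm_sq_eq, Finset.mul_sum, Finset.mul_sum,
      ← Finset.sum_sub_distrib, ← Finset.sum_add_distrib]
    apply Finset.sum_congr rfl
    intro a _
    simp only [hA, add_mul, sub_mul, Finset.sum_add_distrib, Finset.sum_sub_distrib, ite_mul, zero_mul,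
      Finset.sum_ite_eq, Finset.mem_univ, if_true, Real.norm_eq_abs, sq_abs]
    simp only [mul_assoc, ← Finset.mul_sum]
    ring
  have hsn : 0 < Real.sqrt n := by positivity
  have hs2 : Real.sqrt n ^ 2 = n := Real.sq_sqrt (by positivity)
  let u : EuclideanSpace ℝ (Fin n) := WithLp.toLp 2 fun j => (Real.sqrt n)⁻¹ * η j
  let v' : EuclideanSpace ℝ (Fin n) := WithLp.toLp 2 v
  have hu : ∀ j, Real.sqrt n * u j = η j := by
    intro j; simp only [u]; field_simp
  have hu1 : ‖u‖ = 1 := by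
    have : ‖u‖ ^ 2 = 1 := by
      rw [EuclideanSpace.norm_sq_eq]
      have : ∀ j, ‖u j‖ ^ 2 = (n:ℝ)⁻¹ := by
        intro j
        simp only [u, Real.norm_eq_abs, sq_abs]
        rw [mul_pow, sq (η j), hη2, inv_pow, hs2, mul_one]
      simp_rw [this]
      simp
      field_simp
    nlinarith [norm_nonneg u]
  have hv1 : ‖v'‖ = 1 := by
    rw [EuclideanSpace.norm_eq]
    simpa [eucNorm, v'] using hv.1
  have hdot : ∀ x : EuclideanSpace ℝ (Fin n), (∑ b, x b * η b) ^ 2 = n * inner ℝ u x ^ 2 := by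
    intro x
    rw [← hs2, ← mul_pow]
    congr 1
    rw [PiLp.inner_apply, Finset.mul_sum]
    apply Finset.sum_congr rfl
    intro b _
    rw [← hu b]
    simp
    ring
  have htop := aux_top hn A hAsym v' u hv hu1
  rw [hAin, hAin, hdot, hdot, hu1, hv1] at htop
  have hdk := aux_dk (Matrix.toEuclideanLin N) hNT (2 * K) (n * t) (by positivity) hNK u v' hu1 hv1
    (by linarith)
  have hloss := aux_loss hn v' u η hη hu
  calc (n * t) ^ 2 * lossR (fun j => sgn (v j)) η
      ≤ (n * t) ^ 2 * (2 * n * min (‖v' - u‖ ^ 2) (‖v' + u‖ ^ 2)) := by gcongr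
    _ = 2 * n * ((n * t) ^ 2 * min (‖v' - u‖ ^ 2) (‖v' + u‖ ^ 2)) := by ring
    _ ≤ 2 * n * (8 * (2 * K) ^ 2) := by gcongr
    _ = _ := by ring

lemma aux_sq_exp (x a : ℝ) (hx : 0 ≤ x) (ha : 0 ≤ a) :
    x ^ 2 ≤ 64 * a ^ 2 + 8 * (Real.exp (-4 * a) * Real.exp x) := by
  rw [← Real.exp_add]
  by_cases h : x ≤ 8 * a
  · nlinarith [Real.exp_pos (-4 * a + x)]
  · push Not at h
    have h1 : x / 2 ≤ -4 * a + x := by linarith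
    have h2 := Real.quadratic_le_exp_of_nonneg (x := x / 2) (by linarith)
    have h3 := Real.exp_le_exp.2 h1
    nlinarith

lemma aux_EF {p n : ℕ} (σ : ℝ) (θ : Fin p → ℝ) (η : Fin n → ℝ) (hη : η ∈ pmOne n) (l : ℝ)
    (hl : |l| * σ ^ 2 ≤ 1 / 10)
    (hl2 : l ^ 2 * (σ ^ 2 * (p * σ ^ 2 + n * ∑ i, θ i ^ 2)) ≤ n / 100)
    (u : EuclideanSpace ℝ (Fin n)) (hu : u ∈ Metric.ball (0 : EuclideanSpace ℝ (Fin n)) (5 / 4)) :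
    ∫⁻ y, ENNReal.ofReal (Real.exp (l * auxQ σ θ η y u)) ∂(lawY p n σ θ η) ≤
      ENNReal.ofReal (Real.exp n) := by
  have hu1 : ∑ j, u j ^ 2 ≤ 25 / 16 := by
    have h1 : ‖u‖ ≤ 5 / 4 := by
      simpa using (Metric.mem_ball.1 hu).le
    have h2 := EuclideanSpace.norm_sq_eq u
    simp only [Real.norm_eq_abs, sq_abs] at h2
    rw [← h2]
    nlinarith [norm_nonneg u]
  have hη2 : ∑ j, η j ^ 2 = n := by
    have : ∀ j, η j ^ 2 = 1 := by
      intro a; rcases hη a with h | h <;> rw [h] <;> norm_num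
    simp [this]
  have hcs := Finset.sum_mul_sq_le_sq_mul_sq Finset.univ (fun j => u j) η
  rw [hη2] at hcs
  set S := ∑ j, u j ^ 2 with hS
  have hS0 : 0 ≤ S := by positivity
  set t := ∑ i, θ i ^ 2 with ht
  have ht0 : 0 ≤ t := by positivity
  set c := ∑ j, u j * η j
  refine (aux_mgfY σ θ η u l ?_).trans ?_
  · have : |l| * σ ^ 2 * S ≤ 1 / 10 * (25 / 16) := by gcongr
    nlinarith
  · apply ENNReal.ofReal_le_ofReal
    apply Real.exp_le_exp.2
    have h1 : p * (σ ^ 2 * S) ^ 2 + t * c ^ 2 * (σ ^ 2 * S) ≤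
        (25 / 16) ^ 2 * (σ ^ 2 * (p * σ ^ 2 + n * t)) := by
      calc p * (σ ^ 2 * S) ^ 2 + t * c ^ 2 * (σ ^ 2 * S)
          ≤ p * (σ ^ 2 * S) ^ 2 + t * (S * n) * (σ ^ 2 * S) := by gcongr
        _ = S ^ 2 * (σ ^ 2 * (p * σ ^ 2 + n * t)) := by ring
        _ ≤ _ := by gcongr
    have h2 : l ^ 2 * (p * (σ ^ 2 * S) ^ 2 + t * c ^ 2 * (σ ^ 2 * S)) ≤
      l ^ 2 * ((25 / 16) ^ 2 * (σ ^ 2 * (p * σ ^ 2 + n * t))) := by gcongr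
    have h3 : (0:ℝ) ≤ n := by positivity
    nlinarith

instance aux_prob (p n : ℕ) (σ : ℝ) (θ : Fin p → ℝ) (η : Fin n → ℝ) :
    IsProbabilityMeasure (lawY p n σ θ η) := by
  unfold lawY; infer_instance

lemma aux_meas {p n : ℕ} (σ : ℝ) (θ : Fin p → ℝ) (η : Fin n → ℝ) (l : ℝ) :
    Measurable (fun z : (Fin p → Fin n → ℝ) × EuclideanSpace ℝ (Fin n) =>
      ENNReal.ofReal (Real.exp (l * auxQ σ θ η z.1 z.2))) := by
  have : Continuous (fun z : (Fin p → Fin n → ℝ) × EuclideanSpace ℝ (Fin n) =>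
      auxQ σ θ η z.1 z.2) := by
    unfold auxQ; fun_prop
  have := this.measurable
  fun_prop

lemma aux_EF2 {p n : ℕ} (σ : ℝ) (θ : Fin p → ℝ) (η : Fin n → ℝ) (hη : η ∈ pmOne n) (l : ℝ)
    (hl : |l| * σ ^ 2 ≤ 1 / 10) (hl2 : l ^ 2 * (σ ^ 2 * (p * σ ^ 2 + n * ∑ i, θ i ^ 2)) ≤ n / 100)
    (u : EuclideanSpace ℝ (Fin n)) (hu : u ∈ Metric.ball (0 : EuclideanSpace ℝ (Fin n)) (5 / 4)) :
    ∫⁻ y, (ENNReal.ofReal (Real.exp (l * auxQ σ θ η y u)) +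
      ENNReal.ofReal (Real.exp (-l * auxQ σ θ η y u))) ∂(lawY p n σ θ η)
      ≤ ENNReal.ofReal (2 * Real.exp n) := by
  have hm : Measurable (fun y : Fin p → Fin n → ℝ =>
      ENNReal.ofReal (Real.exp (l * auxQ σ θ η y u))) := by
    have hc : Continuous (fun y : Fin p → Fin n → ℝ => auxQ σ θ η y u) := by
      unfold auxQ; fun_prop
    have := hc.measurable
    fun_prop
  rw [lintegral_add_left hm]
  have h1 := aux_EF σ θ η hη l hl hl2 u hu
  have h2 := aux_EF σ θ η hη (-l) (by rwa [abs_neg]) (by rw [neg_sq]; exact hl2) u hu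
  have h3 : ENNReal.ofReal (2 * Real.exp n) = ENNReal.ofReal (Real.exp n) + ENNReal.ofReal (Real.exp n) := by
    rw [← ENNReal.ofReal_add (Real.exp_pos _).le (Real.exp_pos _).le, two_mul]
  rw [h3]
  exact add_le_add h1 h2

set_option maxHeartbeats 1000000 in
lemma aux_risk {p n : ℕ} (hn : 2 ≤ n) (σ : ℝ) (hσ : 0 < σ) (θ : Fin p → ℝ) (η : Fin n → ℝ)
    (hη : η ∈ pmOne n) (hθ : σ ^ 2 ≤ ∑ i, θ i ^ 2)
    (f : (Fin p → Fin n → ℝ) → Fin n → ℝ) (hf : IsSpectralEstimator p n f) :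
    (n : ℝ)⁻¹ * risk p n σ f θ η ≤
      2880000 * (σ ^ 2 * (p * σ ^ 2 + n * ∑ i, θ i ^ 2) / (n * (∑ i, θ i ^ 2) ^ 2)) := by
  obtain ⟨hfm, v, hvm, hv, hfv⟩ := hf
  have hn0 : 0 < n := by omega
  have hnr : (0:ℝ) < n := by positivity
  have hn1 : (1:ℝ) ≤ n := by exact_mod_cast hn0
  set t := ∑ i, θ i ^ 2 with ht
  have ht0 : 0 < t := lt_of_lt_of_le (by positivity) hθ
  set D := σ ^ 2 * (p * σ ^ 2 + n * t) with hD
  have hD0 : 0 < D := by positivity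
  set l := Real.sqrt (n / (100 * D)) with hl
  have hl0 : 0 < l := by positivity
  have hl2 : l ^ 2 = n / (100 * D) := Real.sq_sqrt (by positivity)
  have hlD : l ^ 2 * D = n / 100 := by rw [hl2]; field_simp
  have hls : l * σ ^ 2 ≤ 1 / 10 := by
    refine (pow_le_pow_iff_left₀ (by positivity) (by norm_num) two_ne_zero).1 ?_
    have h1 : σ ^ 2 * (n * σ ^ 2) ≤ D := by
      rw [hD]
      have : (0:ℝ) ≤ p * σ ^ 2 := by positivity
      gcongr
      nlinarith
    have h2 : l ^ 2 * (σ ^ 2 * (n * σ ^ 2)) ≤ l ^ 2 * D := by gcongr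
    rw [hlD] at h2
    have h3 : n * (l * σ ^ 2) ^ 2 ≤ n * (1 / 10) ^ 2 := by nlinarith
    exact le_of_mul_le_mul_left h3 hnr
  set V := volume (Metric.ball (0 : EuclideanSpace ℝ (Fin n)) (1 / 4)) with hV
  have hV0 : V ≠ 0 := (Metric.measure_ball_pos volume _ (by norm_num)).ne'
  have hVt : V ≠ ⊤ := measure_ball_lt_top.ne
  have hV5 : volume (Metric.ball (0 : EuclideanSpace ℝ (Fin n)) (5 / 4)) = ENNReal.ofReal (5 ^ n) * V := by
    have := Measure.addHaar_ball_mul_of_pos (volume : Measure (EuclideanSpace ℝ (Fin n))) 0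
      (r := 5) (by norm_num) (1 / 4)
    rw [finrank_euclideanSpace_fin] at this
    rw [hV, ← this]
    norm_num
  set F : (Fin p → Fin n → ℝ) → ℝ≥0∞ := fun y =>
    ∫⁻ u in Metric.ball (0 : EuclideanSpace ℝ (Fin n)) (5 / 4),
          (ENNReal.ofReal (Real.exp (l * auxQ σ θ η y u)) +
          ENNReal.ofReal (Real.exp (-l * auxQ σ θ η y u))) with hF
  have hmeas : Measurable (fun z : (Fin p → Fin n → ℝ) × EuclideanSpace ℝ (Fin n) =>
      (ENNReal.ofReal (Real.exp (l * auxQ σ θ η z.1 z.2)) +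
          ENNReal.ofReal (Real.exp (-l * auxQ σ θ η z.1 z.2)))) :=
    (aux_meas σ θ η l).add (aux_meas σ θ η (-l))
  have hFm : Measurable F := hmeas.lintegral_prod_right'
  have hEF : ∫⁻ y, F y ∂(lawY p n σ θ η) ≤ ENNReal.ofReal (2 * Real.exp n * 5 ^ n) * V := by
    rw [hF, lintegral_lintegral_swap hmeas.aemeasurable]
    calc _ ≤ ∫⁻ u in Metric.ball (0 : EuclideanSpace ℝ (Fin n)) (5 / 4), ENNReal.ofReal (2 * Real.exp n) := by
          refine setLIntegral_mono' measurableSet_ball fun u hu => ?_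
          exact aux_EF2 σ θ η hη l (by rwa [abs_of_pos hl0]) hlD.le u hu
      _ = _ := by
          rw [setLIntegral_const, hV5, ← mul_assoc, ← ENNReal.ofReal_mul (by positivity)]
  set R := 400 * n / ((n * t) ^ 2 * l ^ 2) with hR
  have hR0 : 0 ≤ R := by positivity
  have hpt : ∀ y, ENNReal.ofReal (lossR (f y) η) ≤
      ENNReal.ofReal (R * (64 * n ^ 2)) + ENNReal.ofReal (R * (8 * Real.exp (-4 * n))) * (F y / V) := by
    intro y
    obtain ⟨K, hK0, hK, hnet⟩ := aux_det hn0 σ θ η hη y (v y) (hv y)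
    have hfy : f y = fun j => sgn (v y j) := funext (hfv y)
    rw [← hfy] at hK
    have h1 : ENNReal.ofReal (Real.exp (2 / 5 * l * K)) ≤ F y / V := by
      rw [ENNReal.le_div_iff_mul_le (Or.inl hV0) (Or.inl hVt)]
      exact hnet l hl0.le
    have h2 := aux_sq_exp (2 / 5 * l * K) n (by positivity) hnr.le
    have h3 : lossR (f y) η ≤ R * (64 * n ^ 2) + R * (8 * Real.exp (-4 * n)) * Real.exp (2 / 5 * l * K) := by
      calc lossR (f y) η ≤ 64 * n * K ^ 2 / (n * t) ^ 2 := by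
            rw [le_div_iff₀ (by positivity)]; linarith
        _ = R * (2 / 5 * l * K) ^ 2 := by rw [hR]; field_simp; ring
        _ ≤ R * (64 * n ^ 2 + 8 * (Real.exp (-4 * n) * Real.exp (2 / 5 * l * K))) := by gcongr
        _ = _ := by ring
    calc _ ≤ _ := ENNReal.ofReal_le_ofReal h3
      _ = ENNReal.ofReal (R * (64 * n ^ 2)) + ENNReal.ofReal (R * (8 * Real.exp (-4 * n))) * ENNReal.ofReal (Real.exp (2 / 5 * l * K)) := by
          rw [ENNReal.ofReal_add (by positivity) (by positivity), ENNReal.ofReal_mul (by positivity : 0 ≤ R * (8 * Real.exp (-4 * n)))]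
      _ ≤ _ := by gcongr
  have hnum : 8 * Real.exp (-4 * n) * (2 * Real.exp n * 5 ^ n) ≤ 8 * (n:ℝ) ^ 2 := by
    have h1 : (2:ℝ) * 5 ^ n ≤ Real.exp (3 * n) := by
      have a1 : (2:ℝ) ≤ 2 ^ n := by
        calc (2:ℝ) = 2 ^ 1 := by norm_num
          _ ≤ 2 ^ n := pow_le_pow_right₀ (by norm_num) hn0
      have a2 : (10:ℝ) ≤ Real.exp 3 := by
        have := Real.exp_one_gt_d9
        have e : Real.exp 3 = Real.exp 1 ^ 3 := by rw [← Real.exp_nat_mul]; norm_num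
        rw [e]
        calc (10:ℝ) ≤ 2.7 ^ 3 := by norm_num
          _ ≤ _ := by gcongr; linarith
      calc (2:ℝ) * 5 ^ n ≤ 2 ^ n * 5 ^ n := by gcongr
        _ = 10 ^ n := by rw [← mul_pow]; norm_num
        _ ≤ Real.exp 3 ^ n := by gcongr
        _ = _ := by rw [← Real.exp_nat_mul]; ring_nf
    calc 8 * Real.exp (-4 * n) * (2 * Real.exp n * 5 ^ n)
        = 8 * Real.exp (-4 * n) * Real.exp n * (2 * 5 ^ n) := by ring
      _ ≤ 8 * Real.exp (-4 * n) * Real.exp n * Real.exp (3 * n) := by gcongr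
      _ = 8 := by
          rw [mul_assoc, mul_assoc, ← Real.exp_add, ← Real.exp_add]
          ring_nf
          simp
      _ ≤ 8 * (n:ℝ) ^ 2 := by nlinarith
  have hint : ∫⁻ y, ENNReal.ofReal (lossR (f y) η) ∂(lawY p n σ θ η) ≤ ENNReal.ofReal (R * (72 * n ^ 2)) := by
    calc _ ≤ ∫⁻ y, (ENNReal.ofReal (R * (64 * n ^ 2)) + ENNReal.ofReal (R * (8 * Real.exp (-4 * n))) * (F y / V)) ∂(lawY p n σ θ η) :=
          lintegral_mono hpt
      _ = ENNReal.ofReal (R * (64 * n ^ 2)) + ENNReal.ofReal (R * (8 * Real.exp (-4 * n))) * ((∫⁻ y, F y ∂(lawY p n σ θ η)) / V) := by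
          rw [lintegral_add_left measurable_const, lintegral_const_mul _ (hFm.div_const V)]
          simp_rw [div_eq_mul_inv]
          rw [lintegral_mul_const _ hFm]
          simp
      _ ≤ ENNReal.ofReal (R * (64 * n ^ 2)) + ENNReal.ofReal (R * (8 * Real.exp (-4 * n))) * ENNReal.ofReal (2 * Real.exp n * 5 ^ n) := by
          gcongr
          exact ENNReal.div_le_of_le_mul hEF
      _ = ENNReal.ofReal (R * (64 * n ^ 2 + 8 * Real.exp (-4 * n) * (2 * Real.exp n * 5 ^ n))) := by
          rw [← ENNReal.ofReal_mul (by positivity), ← ENNReal.ofReal_add (by positivity) (by positivity)]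
          ring_nf
      _ ≤ _ := by
          apply ENNReal.ofReal_le_ofReal
          gcongr
          linarith
  have hloss0 : ∀ y, 0 ≤ lossR (f y) η := fun y => by
    unfold lossR
    exact le_min (Finset.sum_nonneg fun _ _ => abs_nonneg _) (Finset.sum_nonneg fun _ _ => abs_nonneg _)
  have hlm : Measurable fun y => lossR (f y) η := by
    have : ∀ j, Measurable fun y => f y j := fun j => (measurable_pi_apply j).comp hfm
    unfold lossR
    refine Measurable.min ?_ ?_
    · refine Finset.measurable_sum _ fun j _ => ?_
      exact ((this j).sub_const _).abs
    · refine Finset.measurable_sum _ fun j _ => ?_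
      exact ((this j).add_const _).abs
  have hrisk : risk p n σ f θ η ≤ R * (72 * n ^ 2) := by
    unfold risk
    rw [integral_eq_lintegral_of_nonneg_ae (ae_of_all _ hloss0) hlm.aestronglyMeasurable]
    exact ENNReal.toReal_le_of_le_ofReal (by positivity) hint
  calc (n : ℝ)⁻¹ * risk p n σ f θ η ≤ (n : ℝ)⁻¹ * (R * (72 * n ^ 2)) := by gcongr
    _ = _ := by
      rw [hR, hl2]
      field_simp
      norm_num

/-- Theorem 3 (risk bound in expectation): under `r_n ≥ C`, any spectral estimator satisfies
`sup_{Ω_Δ} (1/n) E r(η⁰, η) ≤ C'/r_n² + 32/n²`. -/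
theorem statement5 :
    ∃ C C' : ℝ, 0 < C ∧ 0 < C' ∧
      ∀ (n p : ℕ) (σ Δ : ℝ), 2 ≤ n → 1 ≤ p → 0 < σ → 0 < Δ →
        C ≤ snr p n σ Δ →
        ∀ f : (Fin p → Fin n → ℝ) → Fin n → ℝ, IsSpectralEstimator p n f →
          (⨆ x : Omega p n Δ, (n : ℝ)⁻¹ * risk p n σ f x.1.1 x.1.2)
            ≤ C' / snr p n σ Δ ^ 2 + 32 / (n : ℝ) ^ 2 := by
  refine ⟨1, 2880000, one_pos, by norm_num, ?_⟩
  intro n p σ Δ hn hp hσ hΔ hsnr f hf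
  have hnr : (0:ℝ) < n := by
    have : 0 < n := by omega
    positivity
  have hs0 : 0 < snr p n σ Δ := by linarith
  apply Real.iSup_le
  swap
  · positivity
  rintro ⟨⟨θ, η⟩, hθ, hη⟩
  simp only at hθ hη ⊢
  set x := Δ ^ 2 / σ ^ 2 with hx
  have hx0 : 0 < x := by positivity
  have hsq : snr p n σ Δ ^ 2 = x ^ 2 / (x + p / n) := by
    unfold snr
    rw [div_pow, Real.sq_sqrt (by positivity)]
  have hx1 : 1 ≤ x := by
    have h1 : 1 ≤ x ^ 2 / (x + p / n) := by rw [← hsq]; nlinarith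
    rw [le_div_iff₀ (by positivity)] at h1
    have : (0:ℝ) ≤ p / n := by positivity
    nlinarith
  have hΔt : Δ ^ 2 ≤ ∑ i, θ i ^ 2 := by
    unfold eucNorm at hθ
    exact (Real.le_sqrt' hΔ).1 hθ
  have hσΔ : σ ^ 2 ≤ Δ ^ 2 := by
    rw [hx, le_div_iff₀ (by positivity)] at hx1
    linarith
  have h := aux_risk hn σ hσ θ η hη (hσΔ.trans hΔt) f hf
  refine h.trans ?_
  set t := ∑ i, θ i ^ 2 with ht
  have hΔ2 : 0 < Δ ^ 2 := by positivity
  have ht0 : 0 < t := lt_of_lt_of_le hΔ2 hΔt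
  have h2 : σ ^ 2 * (p * σ ^ 2 + n * t) / (n * t ^ 2) ≤ 1 / snr p n σ Δ ^ 2 := by
    calc σ ^ 2 * (p * σ ^ 2 + n * t) / (n * t ^ 2) = σ ^ 4 * p / n / t ^ 2 + σ ^ 2 / t := by
          field_simp
      _ ≤ σ ^ 4 * p / n / (Δ ^ 2) ^ 2 + σ ^ 2 / Δ ^ 2 := by gcongr
      _ = 1 / snr p n σ Δ ^ 2 := by
          rw [hsq, hx]; field_simp; ring
  have h3 : (0:ℝ) ≤ 32 / (n:ℝ) ^ 2 := by positivity
  calc _ ≤ 2880000 * (1 / snr p n σ Δ ^ 2) := by gcongr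
    _ = 2880000 / snr p n σ Δ ^ 2 := by ring
    _ ≤ _ := by linarith

end
end

section
/- There exist absolute constants C, C' > 0 such that for all sequences p_n ≥ 1, σ_n > 0, Δ_n > 0 with r_n ≥ C for every n, there exists a sequence ε_n → 0 such that for every n and every spectral estimator η⁰, sup_{(θ,η)∈Ω_{Δ_n}} P_{(θ,η)}( (1/n) |ηᵀ η⁰(Y)| ≤ 1 − (log n)/n − C'/r_n² ) ≤ ε_n · Φ^c(r_n). -/
open MeasureTheory ProbabilityTheory Filter Finset Asymptotics
open scoped ENNReal

noncomputable section

lemma row_law {n : ℕ} (z : Fin n → ℝ) (hz : ∑ a, z a ^ 2 = 1) :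
    (Measure.pi fun _ : Fin n => gaussianReal 0 1).map (fun g => ∑ a, g a * z a)
      = gaussianReal 0 1 := by
  have hm : Measurable (fun g : Fin n → ℝ => ∑ a, g a * z a) := by fun_prop
  have : IsProbabilityMeasure
      ((Measure.pi fun _ : Fin n => gaussianReal 0 1).map (fun g => ∑ a, g a * z a)) :=
    Measure.isProbabilityMeasure_map hm.aemeasurable
  apply Measure.ext_of_charFun
  ext t
  rw [charFun_apply_real, integral_map hm.aemeasurable (by fun_prop)]
  have h1 : ∀ g : Fin n → ℝ, Complex.exp (t * ((∑ a, g a * z a : ℝ) : ℂ) * Complex.I)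
      = ∏ a, Complex.exp (((t * z a : ℝ) : ℂ) * (g a : ℂ) * Complex.I) := by
    intro g
    rw [← Complex.exp_sum]
    congr 1
    push_cast
    rw [Finset.mul_sum, Finset.sum_mul]
    refine Finset.sum_congr rfl fun a _ => by ring
  simp_rw [h1]
  rw [integral_fintype_prod_eq_prod
    (f := fun a (x : ℝ) => Complex.exp (((t * z a : ℝ) : ℂ) * (x : ℂ) * Complex.I))]
  simp_rw [← charFun_apply_real, charFun_gaussianReal]
  rw [← Complex.exp_sum]
  congr 1
  have : ((∑ a, z a ^ 2 : ℝ) : ℂ) = 1 := by rw [hz]; simp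
  push_cast at this ⊢
  simp only [mul_zero, zero_mul, zero_sub, one_mul, mul_pow]
  rw [Finset.sum_neg_distrib, ← Finset.sum_div, ← Finset.mul_sum, this]
  simp

lemma log_aux {u : ℝ} (hu : |u| ≤ 1 / 2) : Real.exp (-u - 2 * u ^ 2) ≤ 1 - u := by
  have h := Real.abs_log_sub_add_sum_range_le (x := u) (by linarith) 1
  have h0 : 0 < 1 - u := by have := le_abs_self u; linarith
  simp at h
  rw [← Real.le_log_iff_exp_le h0]
  have h3 : u ^ 2 / (1 - |u|) ≤ 2 * u ^ 2 := by
    rw [div_le_iff₀ (by linarith)]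
    nlinarith [sq_nonneg u, abs_nonneg u]
  linarith [(abs_le.1 h).1]

lemma gauss_sq_mgf {l : ℝ} (hl : |l| ≤ 1 / 4) :
    Integrable (fun x => Real.exp (l * (x ^ 2 - 1))) (gaussianReal 0 1) ∧
      ∫ x, Real.exp (l * (x ^ 2 - 1)) ∂(gaussianReal 0 1) ≤ Real.exp (4 * l ^ 2) := by
  have hb : 0 < 1 / 2 - l := by have := le_abs_self l; linarith
  have hpt : ∀ x : ℝ, gaussianPDFReal 0 1 x • Real.exp (l * (x ^ 2 - 1))
      = ((√(2 * Real.pi))⁻¹ * Real.exp (-l)) * Real.exp (-(1 / 2 - l) * x ^ 2) := by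
    intro x
    simp only [gaussianPDFReal, smul_eq_mul]
    rw [mul_assoc _ (Real.exp (-l)), mul_assoc, ← Real.exp_add, ← Real.exp_add]
    simp
    left
    ring
  constructor
  · rw [gaussianReal_of_var_ne_zero _ one_ne_zero,
      integrable_withDensity_iff_integrable_smul' (measurable_gaussianPDF _ _)
      (ae_of_all _ fun _ => gaussianPDF_lt_top)]
    simp_rw [toReal_gaussianPDF, hpt]
    exact (integrable_exp_neg_mul_sq hb).const_mul _
  · rw [integral_gaussianReal_eq_integral_smul one_ne_zero]
    simp_rw [hpt]
    rw [integral_const_mul, integral_gaussian]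
    have h := log_aux (u := 2 * l) (by rw [abs_mul]; norm_num; linarith)
    have h1 : √(Real.pi / (1 / 2 - l)) = √(2 * Real.pi) * √((1 - 2 * l)⁻¹) := by
      rw [← Real.sqrt_mul (by positivity)]
      congr 1
      have : 1 - 2 * l ≠ 0 := by linarith
      field_simp
    have h2 : √((1 - 2 * l)⁻¹) ≤ Real.exp (l + 4 * l ^ 2) := by
      rw [Real.sqrt_le_left (by positivity), ← Real.exp_nat_mul]
      refine (inv_anti₀ (Real.exp_pos _) h).trans ?_
      rw [← Real.exp_neg]
      apply Real.exp_le_exp.2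
      push_cast
      nlinarith
    have h3 : 0 < √(2 * Real.pi) := by positivity
    rw [h1]
    calc _ = Real.exp (-l) * √((1 - 2 * l)⁻¹) := by field_simp
      _ ≤ Real.exp (-l) * Real.exp (l + 4 * l ^ 2) := by gcongr
      _ = _ := by rw [← Real.exp_add]; congr 1; ring

def stdW (p n : ℕ) : Measure (Fin p → Fin n → ℝ) :=
  Measure.pi fun _ => Measure.pi fun _ => gaussianReal 0 1

instance (p n : ℕ) : IsProbabilityMeasure (stdW p n) := by unfold stdW; infer_instance

lemma chernoff {p n : ℕ} (X : Fin p → ℝ → ℝ) (K : Fin p → ℝ) (t e : ℝ)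
    (ht : 0 ≤ t) (z : Fin n → ℝ) (hz : ∑ a, z a ^ 2 = 1) (hX : ∀ i, Measurable (X i))
    (hi : ∀ i, Integrable (fun x => Real.exp (t * X i x)) (gaussianReal 0 1))
    (hK : ∀ i, ∫ x, Real.exp (t * X i x) ∂(gaussianReal 0 1) ≤ Real.exp (K i)) :
    (stdW p n).real {w | e ≤ ∑ i, X i (∑ a, w i a * z a)} ≤ Real.exp (-t * e + ∑ i, K i) := by
  have hm : Measurable (fun g : Fin n → ℝ => ∑ a, g a * z a) := by fun_prop
  have hsplit : ∀ w : Fin p → Fin n → ℝ, Real.exp (t * ∑ i, X i (∑ a, w i a * z a))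
      = ∏ i, Real.exp (t * X i (∑ a, w i a * z a)) := by
    intro w
    rw [← Real.exp_sum, Finset.mul_sum]
  have hi' : ∀ i, Integrable (fun g : Fin n → ℝ => Real.exp (t * X i (∑ a, g a * z a)))
      (Measure.pi fun _ : Fin n => gaussianReal 0 1) := by
    intro i
    have := hi i
    rw [← row_law z hz] at this
    exact this.comp_measurable hm
  have hIntg : Integrable (fun w => Real.exp (t * ∑ i, X i (∑ a, w i a * z a))) (stdW p n) := by
    simp_rw [hsplit]
    exact Integrable.fintype_prod
      (f := fun i (g : Fin n → ℝ) => Real.exp (t * X i (∑ a, g a * z a))) hi'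
  refine (measure_ge_le_exp_mul_mgf e ht hIntg).trans ?_
  rw [Real.exp_add]
  gcongr
  unfold mgf
  simp_rw [hsplit]
  unfold stdW
  rw [integral_fintype_prod_eq_prod
    (f := fun i (g : Fin n → ℝ) => Real.exp (t * X i (∑ a, g a * z a))), Real.exp_sum]
  refine Finset.prod_le_prod (fun i _ => integral_nonneg fun _ => (Real.exp_pos _).le) ?_
  intro i _
  refine le_trans (le_of_eq ?_) (hK i)
  conv_rhs => rw [← row_law z hz]
  rw [integral_map hm.aemeasurable]
  have := hX i
  exact Measurable.aestronglyMeasurable (by fun_prop)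
  
lemma tail_lin {p n : ℕ} (θ : Fin p → ℝ) (D : ℝ) (hD : 0 < D) (hθ : ∑ i, θ i ^ 2 = D ^ 2)
    (z : Fin n → ℝ) (hz : ∑ a, z a ^ 2 = 1) (t : ℝ) (ht : 0 ≤ t) :
    (stdW p n).real {w | t * D ≤ ∑ i, θ i * ∑ a, w i a * z a} ≤ Real.exp (-t ^ 2 / 2) := by
  have := chernoff (n := n) (fun i x => θ i * x) (fun i => (t / D) ^ 2 / 2 * θ i ^ 2) (t / D) (t * D)
    (by positivity) z hz (fun i => by fun_prop) ?_ ?_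
  · refine this.trans (le_of_eq ?_)
    congr 1
    rw [← Finset.mul_sum, hθ]
    field_simp
    ring
  · intro i
    simp_rw [← mul_assoc]
    exact integrable_exp_mul_gaussianReal _
  · intro i
    simp_rw [← mul_assoc]
    have := congrFun (mgf_fun_id_gaussianReal (μ := 0) (v := 1)) (t / D * θ i)
    unfold mgf at this
    rw [this]
    apply le_of_eq
    congr 1
    push_cast
    ring

lemma tail_sq {p n : ℕ} (hp : 1 ≤ p) (z : Fin n → ℝ) (hz : ∑ a, z a ^ 2 = 1) (L : ℝ) (hL : 0 ≤ L) :
    (stdW p n).real {w | 20 * (√(p * L) + L) ≤ |∑ i, (∑ a, w i a * z a) ^ 2 - p|}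
      ≤ 2 * Real.exp (-L) := by
  set P := √(p : ℝ) with hP
  set Q := √L with hQ
  have hP2 : P ^ 2 = p := Real.sq_sqrt (by positivity)
  have hQ2 : Q ^ 2 = L := Real.sq_sqrt hL
  have hP0 : 0 < P := Real.sqrt_pos.2 (by exact_mod_cast hp)
  have hQ0 : 0 ≤ Q := Real.sqrt_nonneg _
  have hPQ : √(p * L) = P * Q := Real.sqrt_mul (by positivity) _
  set l := Q / (P + 4 * Q) with hl
  have hden : 0 < P + 4 * Q := by positivity
  have hl0 : 0 ≤ l := by positivity
  have hl4 : l ≤ 1 / 4 := by rw [hl, div_le_iff₀ hden]; linarith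
  have hlP : l * P ≤ Q := by rw [hl, div_mul_eq_mul_div, div_le_iff₀ hden]; nlinarith
  have hlPQ : Q ≤ l * (P + Q) * 4 := by
    rw [hl, div_mul_eq_mul_div, div_mul_eq_mul_div, le_div_iff₀ hden]; nlinarith
  have hfin : -l * (20 * (√(p * L) + L)) + 4 * l ^ 2 * p ≤ -L := by
    rw [hPQ, ← hP2, ← hQ2]
    have h1 : (l * P) ^ 2 ≤ Q ^ 2 := by gcongr
    nlinarith
  have A : ∀ s : ℝ, (s = 1 ∨ s = -1) →
      (stdW p n).real {w | 20 * (√(p * L) + L) ≤ ∑ i, s * ((∑ a, w i a * z a) ^ 2 - 1)}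
      ≤ Real.exp (-L) := by
    intro s hs
    have hg := gauss_sq_mgf (l := l * s) (by rcases hs with rfl | rfl <;> simp [abs_of_nonneg hl0] <;> linarith)
    have hs2 : s ^ 2 = 1 := by rcases hs with rfl | rfl <;> norm_num
    have := chernoff (p := p) (n := n) (fun _ x => s * (x ^ 2 - 1)) (fun _ => 4 * l ^ 2) l
      (20 * (√(p * L) + L)) hl0 z hz (fun i => by fun_prop)
      (fun i => by simpa only [mul_assoc] using hg.1)
      (fun i => by simpa only [mul_assoc, mul_pow, hs2, mul_one] using hg.2)
    refine this.trans (Real.exp_le_exp.2 ?_)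
    simp only [Finset.sum_const, Finset.card_univ, Fintype.card_fin, nsmul_eq_mul]
    linarith
  have hsub : {w : Fin p → Fin n → ℝ | 20 * (√(p * L) + L) ≤ |∑ i, (∑ a, w i a * z a) ^ 2 - p|} ⊆
      {w | 20 * (√(p * L) + L) ≤ ∑ i, 1 * ((∑ a, w i a * z a) ^ 2 - 1)} ∪
      {w | 20 * (√(p * L) + L) ≤ ∑ i, (-1) * ((∑ a, w i a * z a) ^ 2 - 1)} := by
    intro w hw
    simp only [Set.mem_ofPred_eq, Set.mem_union, ← Finset.mul_sum, Finset.sum_sub_distrib,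
      Finset.sum_const, Finset.card_univ, Fintype.card_fin, nsmul_eq_mul, mul_one] at hw ⊢
    rcases le_abs.1 hw with h | h
    · left; linarith
    · right; linarith
  calc _ ≤ _ := measureReal_mono hsub
    _ ≤ _ := measureReal_union_le _ _
    _ ≤ _ := by linarith [A 1 (Or.inl rfl), A (-1) (Or.inr rfl)]

lemma eucNorm_sq {n : ℕ} (x : Fin n → ℝ) : eucNorm x ^ 2 = ∑ a, x a ^ 2 :=
  Real.sq_sqrt (Finset.sum_nonneg fun _ _ => sq_nonneg _)

lemma eucNorm_nonneg {n : ℕ} (x : Fin n → ℝ) : 0 ≤ eucNorm x := Real.sqrt_nonneg _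

lemma cs {n : ℕ} (x y : Fin n → ℝ) : |∑ a, x a * y a| ≤ eucNorm x * eucNorm y := by
  apply abs_le_of_sq_le_sq _ (mul_nonneg (eucNorm_nonneg _) (eucNorm_nonneg _))
  rw [mul_pow, eucNorm_sq, eucNorm_sq]
  exact Finset.sum_mul_sq_le_sq_mul_sq _ _ _

lemma exists_net (n : ℕ) (hn : 0 < n) : ∃ N : Finset (Fin n → ℝ), N.card ≤ 5 ^ n ∧
    (∀ x ∈ N, ∑ a, x a ^ 2 = 1) ∧
    ∀ u : Fin n → ℝ, ∃ x ∈ N, 7 / 8 * eucNorm u ≤ ∑ a, x a * u a := by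
  classical
  let E := EuclideanSpace ℝ (Fin n)
  let good : Finset E → Prop := fun s => (∀ c ∈ s, ‖c‖ = 2) ∧
    ∀ c ∈ s, ∀ d ∈ s, c ≠ d → 1 ≤ ‖c - d‖
  have hcard : ∀ s, good s → s.card ≤ 5 ^ n := by
    intro s hs
    have := Besicovitch.card_le_of_separated s (fun c hc => (hs.1 c hc).le) hs.2
    simpa [E] using this
  have hex : ∃ k, ∃ s, good s ∧ s.card = k := ⟨0, ∅, by simp [good], rfl⟩
  let k := Nat.findGreatest (fun k => ∃ s, good s ∧ s.card = k) (5 ^ n)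
  have hk : ∃ s, good s ∧ s.card = k :=
    Nat.findGreatest_spec (P := fun k => ∃ s, good s ∧ s.card = k) (Nat.zero_le _)
      ⟨∅, by simp [good], rfl⟩
  obtain ⟨s, hs, hsk⟩ := hk
  have hmax : ∀ c : E, ‖c‖ = 2 → ∃ d ∈ s, ‖c - d‖ ≤ 1 := by
    intro c hc
    by_contra hcon
    push Not at hcon
    have hcs : c ∉ s := fun h => by have := hcon c h; simp at this; linarith
    have hg : good (insert c s) := by
      refine ⟨fun d hd => ?_, fun d hd e he hde => ?_⟩
      · rcases Finset.mem_insert.1 hd with rfl | h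
        · exact hc
        · exact hs.1 d h
      · rcases Finset.mem_insert.1 hd with rfl | h
        · rcases Finset.mem_insert.1 he with rfl | h'
          · exact absurd rfl hde
          · exact (hcon e h').le
        · rcases Finset.mem_insert.1 he with rfl | h'
          · rw [norm_sub_rev]; exact (hcon d h).le
          · exact hs.2 d h e h' hde
    have h1 := hcard _ hg
    have h2 : (insert c s).card ≤ k :=
      Nat.le_findGreatest (P := fun k => ∃ s, good s ∧ s.card = k) h1 ⟨_, hg, rfl⟩
    rw [Finset.card_insert_of_notMem hcs] at h2
    omega
  have hsum : ∀ c : E, ∑ a, c a ^ 2 = ‖c‖ ^ 2 := by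
    intro c
    rw [EuclideanSpace.norm_sq_eq]
    simp
  let g : E → (Fin n → ℝ) := fun c a => c a / 2
  have hmem : ∀ c : E, ‖c‖ = 2 → ∃ x ∈ s.image g, 7 / 4 ≤ ∑ a, x a * c a := by
    intro c hc
    obtain ⟨d, hd, hcd⟩ := hmax c hc
    refine ⟨g d, Finset.mem_image_of_mem _ hd, ?_⟩
    have h1 := hsum (c - d)
    have h2 : ‖c - d‖ ^ 2 ≤ 1 := by nlinarith [norm_nonneg (c - d)]
    have h3 := hsum c
    have h4 := hsum d
    rw [hc] at h3
    rw [hs.1 d hd] at h4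
    have h5 : ∑ a, (c - d) a ^ 2 = ∑ a, c a ^ 2 + ∑ a, d a ^ 2 - 4 * ∑ a, g d a * c a := by
      rw [Finset.mul_sum, ← Finset.sum_add_distrib, ← Finset.sum_sub_distrib]
      refine Finset.sum_congr rfl fun a _ => ?_
      have : (c - d) a = c a - d a := rfl
      simp only [g, this]
      ring
    rw [h1, h3, h4] at h5
    linarith
  refine ⟨s.image g, Finset.card_image_le.trans (hcard s hs), ?_, ?_⟩
  · intro x hx
    obtain ⟨c, hc, rfl⟩ := Finset.mem_image.1 hx
    have := hsum c
    rw [hs.1 c hc] at this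
    simp only [g, div_pow, ← Finset.sum_div, this]
    norm_num
  · intro u
    by_cases hu : eucNorm u = 0
    · obtain ⟨x, hx, -⟩ := hmem (EuclideanSpace.single ⟨0, hn⟩ 2)
        ((PiLp.norm_single 2 _ _ _).trans (by norm_num))
      refine ⟨x, hx, ?_⟩
      have := cs x u
      rw [hu, mul_zero] at this
      rw [abs_nonpos_iff.1 this, hu]
      simp
    · have hpos : 0 < eucNorm u := lt_of_le_of_ne (eucNorm_nonneg u) (Ne.symm hu)
      obtain ⟨x, hx, h⟩ := hmem (WithLp.toLp 2 fun a => 2 / eucNorm u * u a) (by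
        rw [← sq_eq_sq₀ (norm_nonneg _) (by norm_num), ← hsum]
        simp only [mul_pow, ← Finset.mul_sum, ← eucNorm_sq]
        field_simp)
      refine ⟨x, hx, ?_⟩
      have : ∑ a, x a * (2 / eucNorm u * u a) = 2 / eucNorm u * ∑ a, x a * u a := by
        rw [Finset.mul_sum]; exact Finset.sum_congr rfl fun a _ => by ring
      simp only [] at h
      rw [this, div_mul_eq_mul_div, le_div_iff₀ hpos] at h
      linarith

lemma op_of_net {n : ℕ} (N : Finset (Fin n → ℝ)) 
    (h2 : ∀ u : Fin n → ℝ, ∃ x ∈ N, 7 / 8 * eucNorm u ≤ ∑ a, x a * u a)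
    (A : Fin n → Fin n → ℝ) (T : ℝ) (hT : 0 ≤ T)
    (hA : ∀ x ∈ N, ∀ y ∈ N, ∑ a, ∑ b, x a * A a b * y b ≤ T) (u v : Fin n → ℝ) :
    |∑ a, ∑ b, u a * A a b * v b| ≤ 2 * T * eucNorm u * eucNorm v := by
  have e1 : ∀ u v : Fin n → ℝ, ∑ a, ∑ b, u a * A a b * v b = ∑ a, u a * ∑ b, A a b * v b := by
    intro u v
    refine Finset.sum_congr rfl fun a _ => ?_
    rw [Finset.mul_sum]
    exact Finset.sum_congr rfl fun b _ => by ring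
  have e2 : ∀ u v : Fin n → ℝ, ∑ a, ∑ b, u a * A a b * v b = ∑ b, v b * ∑ a, A a b * u a := by
    intro u v
    rw [Finset.sum_comm]
    refine Finset.sum_congr rfl fun a _ => ?_
    rw [Finset.mul_sum]
    exact Finset.sum_congr rfl fun b _ => by ring
  rw [e1]
  refine (cs _ _).trans ?_
  obtain ⟨x, hx, hxu⟩ := h2 (fun a => ∑ b, A a b * v b)
  rw [← e1, e2] at hxu
  have h3 := (le_abs_self _).trans (cs v (fun b => ∑ a, A a b * x a))
  obtain ⟨y, hy, hyu⟩ := h2 (fun b => ∑ a, A a b * x a)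
  rw [← e2] at hyu
  have h4 := hA x hx y hy
  have hu := eucNorm_nonneg u
  have hv := eucNorm_nonneg v
  have h5 : eucNorm (fun b => ∑ a, A a b * x a) ≤ 8 / 7 * T := by linarith
  have h6 : eucNorm (fun a => ∑ b, A a b * v b) ≤ 2 * T * eucNorm v := by
    have : eucNorm v * eucNorm (fun b => ∑ a, A a b * x a) ≤ eucNorm v * (8 / 7 * T) := by gcongr
    nlinarith [mul_nonneg hv hT]
  calc _ ≤ eucNorm u * (2 * T * eucNorm v) := by gcongr
    _ = _ := by ring

lemma rayleigh {n : ℕ} (M : Fin n → Fin n → ℝ) (hM : ∀ a b, M a b = M b a) (μ : ℝ)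
    (hμ : ∀ μ' : ℝ, (∃ w : Fin n → ℝ, w ≠ 0 ∧ ∀ a, ∑ b, M a b * w b = μ' * w a) → μ' ≤ μ)
    (x : Fin n → ℝ) : ∑ a, x a * ∑ b, M a b * x b ≤ μ * ∑ a, x a ^ 2 := by
  let B : Matrix (Fin n) (Fin n) ℝ := μ • (1 : Matrix (Fin n) (Fin n) ℝ) - Matrix.of M
  have hBm : ∀ w a, (B.mulVec w) a = μ * w a - ∑ b, M a b * w b := by
    intro w a
    simp [B, Matrix.sub_mulVec, Matrix.smul_mulVec]
    rfl
  have hB : B.IsHermitian := by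
    ext a b
    simp [B, Matrix.one_apply, hM a b, eq_comm]
  have hps : B.PosSemidef := by
    rw [hB.posSemidef_iff_eigenvalues_nonneg]
    intro i
    have h := hB.mulVec_eigenvectorBasis i
    have h' := hμ (μ - hB.eigenvalues i) ⟨(hB.eigenvectorBasis i : Fin n → ℝ), ?_, ?_⟩
    · simp only [Pi.zero_apply]; linarith
    · intro h0
      have := hB.eigenvectorBasis.orthonormal.1 i
      have h00 : hB.eigenvectorBasis i = 0 := by ext a; exact congrFun h0 a
      rw [h00] at this
      simp at this
    · intro a
      have h3 := congrFun h a
      rw [hBm] at h3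
      simp at h3
      linarith
  have h := hps.dotProduct_mulVec_nonneg x
  simp only [star_trivial, dotProduct, hBm, mul_sub, Finset.sum_sub_distrib] at h
  have : ∑ a, x a * (μ * x a) = μ * ∑ a, x a ^ 2 := by
    rw [Finset.mul_sum]; exact Finset.sum_congr rfl fun a _ => by ring
  linarith

lemma sgn_cases (s : ℝ) : (sgn s = 1 ∧ 0 ≤ s) ∨ (sgn s = -1 ∧ s ≤ 0) := by
  unfold sgn
  split_ifs with h
  · exact Or.inl ⟨rfl, h⟩
  · exact Or.inr ⟨rfl, (not_le.1 h).le⟩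

lemma sgn_mul_cases (c e v : ℝ) (he : e = 1 ∨ e = -1) :
    sgn c * (e * sgn v) = 1 ∨ (sgn c * (e * sgn v) = -1 ∧ c * (e * v) ≤ 0) := by
  rcases he with rfl | rfl <;> rcases sgn_cases c with ⟨h2, h2'⟩ | ⟨h2, h2'⟩ <;>
    rcases sgn_cases v with ⟨h3, h3'⟩ | ⟨h3, h3'⟩ <;> rw [h2, h3] <;> norm_num <;> nlinarith

set_option maxHeartbeats 1000000 in
lemma spectral_det {n : ℕ} (hn : 0 < n) (M : Fin n → Fin n → ℝ) (hM : ∀ a b, M a b = M b a)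
    (η : Fin n → ℝ) (hη : η ∈ pmOne n) (D2 κ : ℝ) (hD : 0 < D2) (hκ : 0 ≤ κ)
    (E : Fin n → Fin n → ℝ)
    (hME : ∀ a b, M a b = D2 * (η a * η b - if a = b then 1 else 0) + E a b)
    (hE : ∀ x y : Fin n → ℝ, |∑ a, ∑ b, x a * E a b * y b| ≤ κ * eucNorm x * eucNorm y)
    (v : Fin n → ℝ) (hv : IsTopEigenvector M v) :
    1 - 16 * (κ / (n * D2)) ^ 2 ≤ (n : ℝ)⁻¹ * |∑ a, η a * sgn (v a)| := by
  have hn' : (0 : ℝ) < n := by exact_mod_cast hn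
  set ρ := κ / (n * D2) with hρ
  have hρ0 : 0 ≤ ρ := by positivity
  have hκρ : κ = ρ * (n * D2) := by rw [hρ]; field_simp
  have hnn : 0 ≤ (n : ℝ)⁻¹ * |∑ a, η a * sgn (v a)| := by positivity
  by_cases hbig : 1 / 4 ≤ ρ
  · nlinarith
  push Not at hbig
  obtain ⟨hv1, μ, hμ, hmax⟩ := hv
  have hη2 : ∀ a, η a * η a = 1 := fun a => by rcases hη a with h | h <;> rw [h] <;> norm_num
  have hvv : ∑ a, v a ^ 2 = 1 := by rw [← eucNorm_sq, hv1]; norm_num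
  have hηη : ∑ a, η a ^ 2 = n := by simp [sq, hη2]
  have hηn : eucNorm η ^ 2 = n := by rw [eucNorm_sq, hηη]
  have hMx : ∀ x : Fin n → ℝ, ∀ a, ∑ b, M a b * x b
      = D2 * (η a * ∑ b, η b * x b) - D2 * x a + ∑ b, E a b * x b := by
    intro x a
    have : ∀ b, M a b * x b = D2 * (η a * (η b * x b)) - D2 * (if a = b then x b else 0)
        + E a b * x b := by
      intro b
      rw [hME]
      split_ifs <;> ring
    simp_rw [this, Finset.sum_add_distrib, Finset.sum_sub_distrib, ← Finset.mul_sum]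
    simp
  have e1 : ∀ u v : Fin n → ℝ, ∑ a, ∑ b, u a * E a b * v b = ∑ a, u a * ∑ b, E a b * v b := by
    intro u v
    refine Finset.sum_congr rfl fun a _ => ?_
    rw [Finset.mul_sum]
    exact Finset.sum_congr rfl fun b _ => by ring
  have hlam : 3 / 4 * (n * D2) ≤ μ + D2 := by
    have h := rayleigh M hM μ hmax η
    have h1 : ∑ a, η a * ∑ b, M a b * η b
        = D2 * n * n - D2 * n + ∑ a, ∑ b, η a * E a b * η b := by
      have : ∀ a, η a * ∑ b, M a b * η b = D2 * n - D2 + η a * ∑ b, E a b * η b := by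
        intro a
        rw [hMx]
        simp only [hη2, Finset.sum_const, Finset.card_univ, Fintype.card_fin, nsmul_eq_mul]
        linear_combination (D2 * n - D2) * hη2 a
      simp_rw [this, Finset.sum_add_distrib, e1]
      simp
      ring
    have h2 := (abs_le.1 (hE η η)).1
    have h3 : κ * eucNorm η * eucNorm η = κ * n := by rw [mul_assoc, ← sq, hηn]
    rw [h1, hηη] at h
    rw [h3] at h2
    have h4 : D2 * n - D2 - κ ≤ μ := by
      by_contra hc
      push Not at hc
      nlinarith
    nlinarith [mul_pos hn' hD]
  have hlam0 : 0 < μ + D2 := lt_of_lt_of_le (by positivity) hlam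
  set c := ∑ b, η b * v b with hc
  have hvE : ∀ a, (μ + D2) * v a = D2 * (η a * c) + ∑ b, E a b * v b := by
    intro a
    have := hμ a
    rw [hMx] at this
    linarith
  let w : Fin n → ℝ := fun a => v a - c / n * η a
  have hwη : ∑ a, w a * η a = 0 := by
    have : ∀ a, w a * η a = η a * v a - c / n := by
      intro a
      simp only [w]
      linear_combination (-(c / n)) * hη2 a
    simp_rw [this, Finset.sum_sub_distrib, ← hc]
    simp
    field_simp
    ring
  have hw2 : ∑ a, w a ^ 2 = 1 - c ^ 2 / n := by
    have : ∀ a, w a ^ 2 = v a ^ 2 - 2 * (c / n) * (η a * v a) + c ^ 2 / n ^ 2 := by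
      intro a
      simp only [w]
      linear_combination (c ^ 2 / n ^ 2) * hη2 a
    simp_rw [this, Finset.sum_add_distrib, Finset.sum_sub_distrib, ← Finset.mul_sum, ← hc, hvv]
    simp
    field_simp
    ring
  have hwE : (μ + D2) * ∑ a, w a ^ 2 = ∑ a, ∑ b, w a * E a b * v b := by
    rw [e1, Finset.mul_sum]
    have : ∀ a, (μ + D2) * w a ^ 2
        = (D2 * c - (μ + D2) * c / n) * (w a * η a) + w a * ∑ b, E a b * v b := by
      intro a
      have h1 : (μ + D2) * w a ^ 2 = w a * ((μ + D2) * v a) - (μ + D2) * c / n * (w a * η a) := by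
        simp only [w]; ring
      rw [h1, hvE]; ring
    simp_rw [this, Finset.sum_add_distrib, ← Finset.mul_sum, hwη]
    ring
  have hwn := (le_abs_self _).trans (hE w v)
  rw [← hwE, hv1, mul_one, ← eucNorm_sq] at hwn
  have hw0 := eucNorm_nonneg w
  have hwle : (μ + D2) * eucNorm w ≤ κ := by
    by_contra hcon
    push Not at hcon
    rcases hw0.eq_or_lt with h | h
    · rw [← h] at hcon; linarith
    · nlinarith
  have hwρ : eucNorm w ≤ 4 / 3 * ρ := by
    have h1 : 3 / 4 * (n * D2) * eucNorm w ≤ ρ * (n * D2) := by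
      rw [← hκρ]; exact le_trans (by gcongr) hwle
    have h2 : 0 < n * D2 := by positivity
    by_contra hcon
    push Not at hcon
    nlinarith
  have hq : ∑ a, w a ^ 2 ≤ 16 / 9 * ρ ^ 2 := by
    rw [← eucNorm_sq]
    calc eucNorm w ^ 2 ≤ (4 / 3 * ρ) ^ 2 := by gcongr
      _ = _ := by ring
  have hcc : 8 / 9 ≤ c ^ 2 / n := by nlinarith
  have hpt : ∀ a, c ^ 2 / n ^ 2 * (1 - sgn c * (η a * sgn (v a))) ≤ 2 * w a ^ 2 := by
    intro a
    have hexp : w a ^ 2 = v a ^ 2 - 2 * (c * (η a * v a)) / n + c ^ 2 / n ^ 2 := by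
      simp only [w]
      linear_combination (c ^ 2 / n ^ 2) * hη2 a
    have hgood : sgn c * (η a * sgn (v a)) = 1 →
        c ^ 2 / n ^ 2 * (1 - sgn c * (η a * sgn (v a))) ≤ 2 * w a ^ 2 := by
      intro h; rw [h]; simp; positivity
    have hbad : sgn c * (η a * sgn (v a)) = -1 → c * (η a * v a) ≤ 0 →
        c ^ 2 / n ^ 2 * (1 - sgn c * (η a * sgn (v a))) ≤ 2 * w a ^ 2 := by
      intro h h'
      rw [h, hexp]
      have h3 : 2 * (c * (η a * v a)) / n ≤ 0 := div_nonpos_of_nonpos_of_nonneg (by linarith) hn'.le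
      nlinarith [sq_nonneg (v a)]
    rcases sgn_mul_cases c (η a) (v a) (hη a) with h | ⟨h, h'⟩
    · exact hgood h
    · exact hbad h h'
  have hsum := Finset.sum_le_sum fun a (_ : a ∈ Finset.univ) => hpt a
  rw [← Finset.mul_sum, ← Finset.mul_sum, Finset.sum_sub_distrib, ← Finset.mul_sum] at hsum
  simp only [Finset.sum_const, Finset.card_univ, Fintype.card_fin, nsmul_eq_mul, mul_one] at hsum
  have habs : sgn c * ∑ a, η a * sgn (v a) ≤ |∑ a, η a * sgn (v a)| := by
    rcases sgn_cases c with ⟨h2, -⟩ | ⟨h2, -⟩ <;> rw [h2]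
    · rw [one_mul]; exact le_abs_self _
    · rw [neg_one_mul]; exact neg_le_abs _
  set X := |∑ a, η a * sgn (v a)| with hX
  have h5 : c ^ 2 / n * (1 - (n : ℝ)⁻¹ * X) ≤ 2 * (16 / 9 * ρ ^ 2) := by
    have : c ^ 2 / n * (1 - (n : ℝ)⁻¹ * X) = c ^ 2 / n ^ 2 * (n - X) := by field_simp
    rw [this]
    calc c ^ 2 / n ^ 2 * (n - X) ≤ c ^ 2 / n ^ 2 * (n - sgn c * ∑ a, η a * sgn (v a)) := by gcongr
      _ ≤ _ := hsum
      _ ≤ _ := by linarith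
  by_contra hcon
  push Not at hcon
  nlinarith [sq_nonneg ρ]

lemma diag_bound {n : ℕ} (d x y : Fin n → ℝ) (m : ℝ) (hm : 0 ≤ m) (hd : ∀ a, |d a| ≤ m) :
    |∑ a, x a * d a * y a| ≤ m * eucNorm x * eucNorm y := by
  have h1 : eucNorm (fun a => d a * y a) ≤ m * eucNorm y := by
    rw [← abs_of_nonneg (eucNorm_nonneg (fun a => d a * y a))]
    apply abs_le_of_sq_le_sq _ (mul_nonneg hm (eucNorm_nonneg _))
    rw [mul_pow, eucNorm_sq, eucNorm_sq, Finset.mul_sum]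
    refine Finset.sum_le_sum fun a _ => ?_
    rw [mul_pow]
    exact mul_le_mul_of_nonneg_right
      (sq_le_sq' (by linarith [(abs_le.1 (hd a)).1]) (le_of_abs_le (hd a))) (sq_nonneg _)
  simp_rw [mul_assoc (x _)]
  refine (cs x _).trans ?_
  calc _ ≤ eucNorm x * (m * eucNorm y) := by gcongr; exact eucNorm_nonneg _
    _ = _ := by ring

lemma coord_le {n : ℕ} (x : Fin n → ℝ) (a : Fin n) : |x a| ≤ eucNorm x := by
  apply abs_le_of_sq_le_sq _ (eucNorm_nonneg _)
  rw [eucNorm_sq]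
  exact Finset.single_le_sum (f := fun a => x a ^ 2) (fun _ _ => sq_nonneg _) (Finset.mem_univ a)

lemma eucNorm_pm {n : ℕ} (η : Fin n → ℝ) (hη : η ∈ pmOne n) : eucNorm η = √(n : ℝ) := by
  unfold eucNorm
  congr 1
  have : ∀ a, η a ^ 2 = 1 := fun a => by rcases hη a with h | h <;> rw [h] <;> norm_num
  simp [this]

lemma E_bound {n : ℕ} (hn : 0 < n) (η ξ : Fin n → ℝ) (hη : η ∈ pmOne n) (σ R T : ℝ)
    (hσ : 0 < σ) (hT : 0 ≤ T) (hR : eucNorm ξ ≤ R) (G : Fin n → Fin n → ℝ)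
    (hG : ∀ x y : Fin n → ℝ, |∑ a, ∑ b, x a * G a b * y b| ≤ 2 * T * eucNorm x * eucNorm y)
    (hd : ∀ a, |G a a| ≤ T) (x y : Fin n → ℝ) :
    |∑ a, ∑ b, x a * (if a = b then 0 else σ * (η a * ξ b + η b * ξ a) + σ ^ 2 * G a b) * y b|
      ≤ (4 * σ * √(n : ℝ) * R + 3 * σ ^ 2 * T) * eucNorm x * eucNorm y := by
  have hR0 : 0 ≤ R := (eucNorm_nonneg _).trans hR
  have h1 : 1 ≤ √(n : ℝ) := by
    rw [Real.one_le_sqrt]; exact_mod_cast hn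
  have key : ∑ a, ∑ b, x a * (if a = b then 0 else σ * (η a * ξ b + η b * ξ a) + σ ^ 2 * G a b) * y b
      = σ * ((∑ a, x a * η a) * ∑ b, ξ b * y b) + σ * ((∑ a, x a * ξ a) * ∑ b, η b * y b)
        + σ ^ 2 * (∑ a, ∑ b, x a * G a b * y b)
        - ∑ a, x a * (2 * σ * η a * ξ a + σ ^ 2 * G a a) * y a := by
    rw [Finset.sum_mul_sum, Finset.sum_mul_sum]
    simp_rw [Finset.mul_sum]
    rw [← Finset.sum_add_distrib, ← Finset.sum_add_distrib, ← Finset.sum_sub_distrib]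
    refine Finset.sum_congr rfl fun a _ => ?_
    rw [← Finset.sum_add_distrib, ← Finset.sum_add_distrib]
    have : x a * (2 * σ * η a * ξ a + σ ^ 2 * G a a) * y a
        = ∑ b, if a = b then x a * (2 * σ * η a * ξ a + σ ^ 2 * G a a) * y a else 0 := by simp
    rw [this, ← Finset.sum_sub_distrib]
    refine Finset.sum_congr rfl fun b _ => ?_
    split_ifs with h
    · subst h; ring
    · ring
  rw [key]
  have b1 : |∑ a, x a * η a| ≤ eucNorm x * √(n : ℝ) := by rw [← eucNorm_pm η hη]; exact cs _ _
  have b2 : |∑ a, η a * y a| ≤ √(n : ℝ) * eucNorm y := by rw [← eucNorm_pm η hη]; exact cs _ _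
  have hx := eucNorm_nonneg x
  have hy := eucNorm_nonneg y
  have b3 : |∑ a, x a * ξ a| ≤ eucNorm x * R := (cs _ _).trans (by gcongr)
  have b4 : |∑ a, ξ a * y a| ≤ R * eucNorm y := (cs _ _).trans (by gcongr)
  have b5 : |∑ a, x a * (2 * σ * η a * ξ a + σ ^ 2 * G a a) * y a|
      ≤ (2 * σ * R + σ ^ 2 * T) * eucNorm x * eucNorm y := by
    apply diag_bound _ _ _ _ (by positivity)
    intro a
    have hηa : |η a| = 1 := by rcases hη a with h | h <;> rw [h] <;> norm_num
    have hξ := (coord_le ξ a).trans hR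
    calc _ ≤ |2 * σ * η a * ξ a| + |σ ^ 2 * G a a| := abs_add_le _ _
      _ = 2 * σ * |ξ a| + σ ^ 2 * |G a a| := by
        rw [abs_mul, abs_mul, abs_mul, abs_mul, hηa, abs_of_pos hσ, abs_of_pos (pow_pos hσ 2)]
        norm_num
      _ ≤ _ := by gcongr; exact hd a
  have b6 := hG x y
  have c1 : |σ * ((∑ a, x a * η a) * ∑ b, ξ b * y b)|
      ≤ σ * ((eucNorm x * √(n : ℝ)) * (R * eucNorm y)) := by
    rw [abs_mul, abs_mul, abs_of_pos hσ]; gcongr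
  have c2 : |σ * ((∑ a, x a * ξ a) * ∑ b, η b * y b)|
      ≤ σ * ((eucNorm x * R) * (√(n : ℝ) * eucNorm y)) := by
    rw [abs_mul, abs_mul, abs_of_pos hσ]; gcongr
  have c3 : |σ ^ 2 * (∑ a, ∑ b, x a * G a b * y b)| ≤ σ ^ 2 * (2 * T * eucNorm x * eucNorm y) := by
    rw [abs_mul, abs_of_pos (pow_pos hσ 2)]; gcongr
  have c5 : 2 * σ * R * (eucNorm x * eucNorm y) ≤ 2 * σ * R * (eucNorm x * eucNorm y) * √(n : ℝ) :=
    le_mul_of_one_le_right (by positivity) h1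
  have t1 := abs_sub (σ * ((∑ a, x a * η a) * ∑ b, ξ b * y b)
    + σ * ((∑ a, x a * ξ a) * ∑ b, η b * y b) + σ ^ 2 * (∑ a, ∑ b, x a * G a b * y b))
    (∑ a, x a * (2 * σ * η a * ξ a + σ ^ 2 * G a a) * y a)
  have t2 := abs_add_three (σ * ((∑ a, x a * η a) * ∑ b, ξ b * y b))
    (σ * ((∑ a, x a * ξ a) * ∑ b, η b * y b)) (σ ^ 2 * (∑ a, ∑ b, x a * G a b * y b))
  linarith

/-- centered Gram matrix -/
def Gc {p n : ℕ} (w : Fin p → Fin n → ℝ) (a b : Fin n) : ℝ :=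
  ∑ i, w i a * w i b - if a = b then (p : ℝ) else 0

lemma Gc_bil {p n : ℕ} (w : Fin p → Fin n → ℝ) (x y : Fin n → ℝ) :
    ∑ a, ∑ b, x a * Gc w a b * y b
      = ∑ i, (∑ a, w i a * x a) * (∑ a, w i a * y a) - p * ∑ a, x a * y a := by
  have h1 : ∀ a b, x a * Gc w a b * y b
      = ∑ i, (w i a * x a) * (w i b * y b) - if a = b then p * (x a * y b) else 0 := by
    intro a b
    simp only [Gc, mul_sub, sub_mul, Finset.mul_sum, Finset.sum_mul]
    congr 1
    · exact Finset.sum_congr rfl fun i _ => by ring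
    · split_ifs <;> ring
  simp_rw [h1, Finset.sum_sub_distrib, Finset.sum_mul_sum]
  congr 1
  · have : ∀ a, ∑ b, ∑ i, (w i a * x a) * (w i b * y b)
        = ∑ i, ∑ b, (w i a * x a) * (w i b * y b) := fun a => Finset.sum_comm
    simp_rw [this]
    exact Finset.sum_comm
  · simp [Finset.mul_sum]

lemma Gc_net {p n : ℕ} (w : Fin p → Fin n → ℝ) (x y : Fin n → ℝ) (T : ℝ)
    (hx : ∑ a, x a ^ 2 = 1) (hy : ∑ a, y a ^ 2 = 1)
    (h1 : |∑ i, (∑ a, w i a * (x a + y a)) ^ 2 - p * ∑ a, (x a + y a) ^ 2|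
      ≤ T * ∑ a, (x a + y a) ^ 2)
    (h2 : |∑ i, (∑ a, w i a * (x a - y a)) ^ 2 - p * ∑ a, (x a - y a) ^ 2|
      ≤ T * ∑ a, (x a - y a) ^ 2) :
    ∑ a, ∑ b, x a * Gc w a b * y b ≤ T := by
  rw [Gc_bil]
  have e1 : ∑ a, (x a + y a) ^ 2 = 2 + 2 * ∑ a, x a * y a := by
    have : ∀ a, (x a + y a) ^ 2 = x a ^ 2 + y a ^ 2 + 2 * (x a * y a) := fun a => by ring
    simp_rw [this, Finset.sum_add_distrib, ← Finset.mul_sum, hx, hy]; ring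
  have e2 : ∑ a, (x a - y a) ^ 2 = 2 - 2 * ∑ a, x a * y a := by
    have : ∀ a, (x a - y a) ^ 2 = x a ^ 2 + y a ^ 2 - 2 * (x a * y a) := fun a => by ring
    simp_rw [this, Finset.sum_sub_distrib, Finset.sum_add_distrib, ← Finset.mul_sum, hx, hy]; ring
  have e3 : ∑ i, (∑ a, w i a * (x a + y a)) ^ 2 - ∑ i, (∑ a, w i a * (x a - y a)) ^ 2
      = 4 * ∑ i, (∑ a, w i a * x a) * (∑ a, w i a * y a) := by
    rw [← Finset.sum_sub_distrib, Finset.mul_sum]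
    refine Finset.sum_congr rfl fun i _ => ?_
    simp_rw [mul_add, mul_sub, Finset.sum_add_distrib, Finset.sum_sub_distrib]
    ring
  rw [e1] at h1
  rw [e2] at h2
  linarith [(abs_le.1 h1).2, (abs_le.1 h2).1]

lemma quad_scale {p n : ℕ} (w : Fin p → Fin n → ℝ) (u : Fin n → ℝ) (T : ℝ)
    (h : eucNorm u ≠ 0 → |∑ i, (∑ a, w i a * (u a / eucNorm u)) ^ 2 - p| ≤ T) :
    |∑ i, (∑ a, w i a * u a) ^ 2 - p * ∑ a, u a ^ 2| ≤ T * ∑ a, u a ^ 2 := by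
  by_cases hu : eucNorm u = 0
  · have h0 : ∀ a, u a = 0 := fun a => abs_nonpos_iff.1 (by rw [← hu]; exact coord_le u a)
    simp [h0]
  · have h' := h hu
    have e : ∑ i, (∑ a, w i a * u a) ^ 2 - p * ∑ a, u a ^ 2
        = (∑ i, (∑ a, w i a * (u a / eucNorm u)) ^ 2 - p) * eucNorm u ^ 2 := by
      rw [sub_mul, Finset.sum_mul, eucNorm_sq]
      congr 1
      refine Finset.sum_congr rfl fun i _ => ?_
      simp_rw [← mul_div_assoc, ← Finset.sum_div]
      rw [← eucNorm_sq]
      field_simp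
    rw [e, abs_mul, abs_of_nonneg (sq_nonneg (eucNorm u)), ← eucNorm_sq u]
    exact mul_le_mul_of_nonneg_right h' (sq_nonneg _)

lemma core {p n : ℕ} (hp : 1 ≤ p) (hn : 0 < n) (θ : Fin p → ℝ) (hD : 0 < eucNorm θ)
    (L σ : ℝ) (hL : 0 ≤ L) (hσ : 0 < σ) (η : Fin n → ℝ) (hη : η ∈ pmOne n) :
    ∃ B : Set (Fin p → Fin n → ℝ),
      (stdW p n).real B ≤ 7 * 25 ^ n * Real.exp (-L) ∧
      ∀ w ∉ B, ∀ v : Fin n → ℝ,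
        IsTopEigenvector (hollowGram fun i a => θ i * η a + σ * w i a) v →
        1 - 16 * ((4 * σ * √(n : ℝ) * (2 * eucNorm θ * √L)
          + 3 * σ ^ 2 * (20 * (√(p * L) + L))) / (n * eucNorm θ ^ 2)) ^ 2
          ≤ (n : ℝ)⁻¹ * |∑ a, η a * sgn (v a)| := by
  classical
  obtain ⟨N, hNc, hN1, hN2⟩ := exists_net n hn
  set D := eucNorm θ with hDdef
  set T := 20 * (√(p * L) + L) with hTdef
  have hT : 0 ≤ T := by positivity
  let nz : (Fin n → ℝ) → (Fin n → ℝ) := fun u a => u a / eucNorm u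
  let Z0 : Finset (Fin n → ℝ) :=
    ((N ×ˢ N).image fun q => nz fun a => q.1 a + q.2 a) ∪
    ((N ×ˢ N).image fun q => nz fun a => q.1 a - q.2 a) ∪
    Finset.univ.image fun b => (fun a : Fin n => if a = b then (1 : ℝ) else 0)
  let Z := Z0.filter fun z => ∑ a, z a ^ 2 = 1
  have hZc : Z.card ≤ 2 * 25 ^ n + n := by
    have h1 : (N ×ˢ N).card ≤ 25 ^ n := by
      rw [Finset.card_product]
      calc N.card * N.card ≤ 5 ^ n * 5 ^ n := Nat.mul_le_mul hNc hNc
        _ = 25 ^ n := by rw [← mul_pow]; norm_num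
    have h2 : Z.card ≤ Z0.card := Finset.card_filter_le _ _
    have h3 : Z0.card ≤ _ := Finset.card_union_le _ _
    have h4 := Finset.card_union_le ((N ×ˢ N).image fun q => nz fun a => q.1 a + q.2 a)
      ((N ×ˢ N).image fun q => nz fun a => q.1 a - q.2 a)
    have h5 : ((N ×ˢ N).image fun q => nz fun a => q.1 a + q.2 a).card ≤ _ := Finset.card_image_le
    have h6 : ((N ×ˢ N).image fun q => nz fun a => q.1 a - q.2 a).card ≤ _ := Finset.card_image_le
    have h7 : (Finset.univ.image fun b => (fun a : Fin n => if a = b then (1 : ℝ) else 0)).card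
      ≤ _ := Finset.card_image_le
    simp only [Finset.card_univ, Fintype.card_fin] at h7
    omega
  let B1 : (Fin n → ℝ) → Set (Fin p → Fin n → ℝ) :=
    fun z => {w | T ≤ |∑ i, (∑ a, w i a * z a) ^ 2 - p|}
  let B2 : (Fin n → ℝ) → Set (Fin p → Fin n → ℝ) :=
    fun z => {w | √(2 * L) * D ≤ ∑ i, θ i * ∑ a, w i a * z a}
  refine ⟨(⋃ z ∈ Z, B1 z) ∪ ⋃ z ∈ N, B2 z, ?_, ?_⟩
  · have h1 : (stdW p n).real (⋃ z ∈ Z, B1 z) ≤ Z.card * (2 * Real.exp (-L)) := by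
      refine (measureReal_biUnion_finset_le _ _).trans ?_
      rw [← nsmul_eq_mul]
      refine Finset.sum_le_card_nsmul _ _ _ fun z hz => ?_
      exact tail_sq hp z (Finset.mem_filter.1 hz).2 L hL
    have h2 : (stdW p n).real (⋃ z ∈ N, B2 z) ≤ N.card * Real.exp (-L) := by
      refine (measureReal_biUnion_finset_le _ _).trans ?_
      rw [← nsmul_eq_mul]
      refine Finset.sum_le_card_nsmul _ _ _ fun z hz => ?_
      refine (tail_lin θ D hD (eucNorm_sq θ).symm z (hN1 z hz) _ (Real.sqrt_nonneg _)).trans ?_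
      rw [Real.sq_sqrt (by positivity)]
      apply Real.exp_le_exp.2
      linarith
    refine (measureReal_union_le _ _).trans ((add_le_add h1 h2).trans ?_)
    have hn25 : n ≤ 25 ^ n := (Nat.lt_pow_self (by norm_num)).le
    have h55 : 5 ^ n ≤ 25 ^ n := Nat.pow_le_pow_left (by norm_num) n
    have h3 : 2 * Z.card + N.card ≤ 7 * 25 ^ n := by omega
    have h4 : (2 * Z.card + N.card : ℝ) ≤ 7 * 25 ^ n := by exact_mod_cast h3
    have := Real.exp_pos (-L)
    nlinarith
  · intro w hw v hv
    simp only [Set.mem_union, Set.mem_iUnion, not_or, not_exists] at hw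
    have g1 : ∀ z ∈ Z, |∑ i, (∑ a, w i a * z a) ^ 2 - p| ≤ T := fun z hz =>
      (not_le.1 (hw.1 z hz)).le
    have g2 : ∀ z ∈ N, ∑ i, θ i * ∑ a, w i a * z a ≤ √(2 * L) * D := fun z hz =>
      (not_le.1 (hw.2 z hz)).le
    have hnz : ∀ u : Fin n → ℝ, eucNorm u ≠ 0 → ∑ a, nz u a ^ 2 = 1 := by
      intro u hu
      simp only [nz, div_pow, ← Finset.sum_div]
      rw [← eucNorm_sq]
      field_simp
    have hq : ∀ x ∈ N, ∀ y ∈ N, ∑ a, ∑ b, x a * Gc w a b * y b ≤ T := by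
      intro x hx y hy
      apply Gc_net w x y T (hN1 x hx) (hN1 y hy)
      · apply quad_scale
        intro hu
        refine g1 (nz fun a => x a + y a) (Finset.mem_filter.2 ⟨?_, hnz _ hu⟩)
        exact Finset.mem_union_left _ (Finset.mem_union_left _ (Finset.mem_image.2
          ⟨(x, y), Finset.mem_product.2 ⟨hx, hy⟩, rfl⟩))
      · apply quad_scale
        intro hu
        refine g1 (nz fun a => x a - y a) (Finset.mem_filter.2 ⟨?_, hnz _ hu⟩)
        exact Finset.mem_union_left _ (Finset.mem_union_right _ (Finset.mem_image.2
          ⟨(x, y), Finset.mem_product.2 ⟨hx, hy⟩, rfl⟩))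
    have hG := op_of_net N hN2 (Gc w) T hT hq
    have hdiag : ∀ b, |Gc w b b| ≤ T := by
      intro b
      have := g1 (fun a : Fin n => if a = b then (1 : ℝ) else 0) (Finset.mem_filter.2 ⟨?_, ?_⟩)
      · simpa [Gc, sq] using this
      · exact Finset.mem_union_right _ (Finset.mem_image.2 ⟨b, Finset.mem_univ _, rfl⟩)
      · simp
    let ξ : Fin n → ℝ := fun a => ∑ i, θ i * w i a
    have hξ : eucNorm ξ ≤ 2 * D * √L := by
      obtain ⟨x, hx, hxξ⟩ := hN2 ξ
      have h1 := g2 x hx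
      have h2 : ∑ a, x a * ξ a = ∑ i, θ i * ∑ a, w i a * x a := by
        simp only [ξ, Finset.mul_sum]
        rw [Finset.sum_comm]
        exact Finset.sum_congr rfl fun i _ => Finset.sum_congr rfl fun a _ => by ring
      rw [← h2] at h1
      have h3 : √(2 * L) ≤ 3 / 2 * √L := by
        rw [Real.sqrt_mul (by norm_num)]
        gcongr
        rw [Real.sqrt_le_left (by norm_num)]
        norm_num
      have h4 : √(2 * L) * D ≤ 3 / 2 * √L * D := by gcongr
      have h5 : 0 ≤ √L * D := by positivity
      nlinarith
    have hEb := E_bound hn η ξ hη σ (2 * D * √L) T hσ hT hξ (Gc w) hG hdiag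
    have hη2 : ∀ a, η a * η a = 1 := fun a => by rcases hη a with h | h <;> rw [h] <;> norm_num
    refine spectral_det hn _ ?_ η hη (D ^ 2) _ (by positivity) (by positivity)
      (fun a b => if a = b then 0 else σ * (η a * ξ b + η b * ξ a) + σ ^ 2 * Gc w a b) ?_ hEb v hv
    · intro a b
      unfold hollowGram
      simp only [eq_comm (a := a) (b := b)]
      split_ifs
      · rfl
      · exact Finset.sum_congr rfl fun i _ => by ring
    · intro a b
      unfold hollowGram
      split_ifs with h
      · subst h; rw [hη2]; ring
      · simp only [Gc, if_neg h, ξ, hDdef, eucNorm_sq, Finset.mul_sum, Finset.sum_mul, sub_zero, mul_add]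
        simp only [← Finset.sum_add_distrib]
        exact Finset.sum_congr rfl fun i _ => by ring

lemma lawY_eq (p n : ℕ) (σ : ℝ) (θ : Fin p → ℝ) (η : Fin n → ℝ) :
    lawY p n σ θ η = (stdW p n).map (fun w i a => θ i * η a + σ * w i a) := by
  have h0 : ∀ c : ℝ, (gaussianReal 0 1).map (fun x => c + σ * x)
      = gaussianReal c (σ ^ 2).toNNReal := by
    intro c
    have : (fun x => c + σ * x) = (fun x => c + x) ∘ (fun x => σ * x) := rfl
    rw [this, ← Measure.map_map (by fun_prop) (by fun_prop), gaussianReal_map_const_mul,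
      gaussianReal_map_const_add]
    congr 1
    · simp
    · rw [mul_one]
      ext
      simp [sq_nonneg]
  unfold lawY stdW
  have hm : ∀ i, Measurable (fun (g : Fin n → ℝ) a => θ i * η a + σ * g a) := by
    intro i; fun_prop
  have h1 : ∀ i, (Measure.pi fun _ : Fin n => gaussianReal 0 1).map
      (fun g a => θ i * η a + σ * g a)
      = Measure.pi fun j => gaussianReal (θ i * η j) (σ ^ 2).toNNReal := by
    intro i
    have hpm : ∀ a, IsProbabilityMeasure ((gaussianReal 0 1).map (fun x => θ i * η a + σ * x)) := by
      intro a; rw [h0]; infer_instance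
    rw [Measure.pi_map_pi (f := fun a (x : ℝ) => θ i * η a + σ * x)
      (fun a => by fun_prop)]
    simp_rw [h0]
  have hpm : ∀ i, IsProbabilityMeasure ((Measure.pi fun _ : Fin n => gaussianReal 0 1).map
      (fun g a => θ i * η a + σ * g a)) := by
    intro i; rw [h1]; infer_instance
  rw [Measure.pi_map_pi (f := fun i (g : Fin n → ℝ) a => θ i * η a + σ * g a)
    (fun i => (hm i).aemeasurable)]
  simp_rw [h1]

lemma Phic_lower {t : ℝ} (ht : 0 ≤ t) :
    (√(2 * Real.pi))⁻¹ * Real.exp (-1) * Real.exp (-t ^ 2) ≤ Phic t := by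
  unfold Phic
  rw [gaussianReal_apply_eq_integral _ one_ne_zero,
    ENNReal.toReal_ofReal (integral_nonneg fun _ => gaussianPDFReal_nonneg _ _ _)]
  have hIntg : Integrable (gaussianPDFReal 0 1) := integrable_gaussianPDFReal _ _
  have h1 : ∫ x in Set.Ioc t (t + 1), gaussianPDFReal 0 1 x
      ≤ ∫ x in {x | t < x}, gaussianPDFReal 0 1 x := by
    apply setIntegral_mono_set hIntg.integrableOn
    · exact ae_of_all _ fun _ => gaussianPDFReal_nonneg _ _ _
    · exact (Set.Ioc_subset_Ioi_self).eventuallyLE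
  refine le_trans ?_ h1
  have h2 : ∫ _ in Set.Ioc t (t + 1), (√(2 * Real.pi))⁻¹ * Real.exp (-1) * Real.exp (-t ^ 2)
      ≤ ∫ x in Set.Ioc t (t + 1), gaussianPDFReal 0 1 x := by
    apply setIntegral_mono_on (integrableOn_const (by simp)) hIntg.integrableOn measurableSet_Ioc
    intro x hx
    unfold gaussianPDFReal
    rw [mul_assoc, ← Real.exp_add]
    simp only [NNReal.coe_one, mul_one, sub_zero]
    gcongr
    nlinarith [hx.1, hx.2, sq_nonneg (t - 1)]
  refine le_trans (le_of_eq ?_) h2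
  simp

lemma num_aux {m P S r d : ℝ} (hm : 1 ≤ m) (hP : 0 ≤ P) (hS0 : 0 ≤ S) (hS : S ^ 2 = 6 * m ^ 2 + r ^ 2)
    (hr : 1 ≤ r) (hrd : r ≤ d) (hPd : r * P ≤ m * d ^ 2) :
    (8 * m * d * S + 60 * (P * S + S ^ 2)) / (m ^ 2 * d ^ 2) ≤ 600 * (1 / r + 1 / m) := by
  have hm0 : 0 < m := by linarith
  have hr0 : 0 < r := by linarith
  have hd0 : 0 < d := by linarith
  have hS3 : S ≤ 3 * m + r := abs_le_of_sq_le_sq' (by nlinarith) (by positivity) |>.2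
  have hSm : S / m ≤ 3 + r / m := by
    rw [div_le_iff₀ hm0]
    have : (3 + r / m) * m = 3 * m + r := by field_simp
    linarith
  have hrr : 1 / r ≤ 1 := by rw [div_le_one hr0]; exact hr
  have hmm : 1 / m ≤ 1 := by rw [div_le_one hm0]; exact hm
  have hdr : 1 / d ≤ 1 / r := one_div_le_one_div_of_le hr0 hrd
  have hr1 : 0 < 1 / r := by positivity
  have hm1 : 0 < 1 / m := by positivity
  have hd1 : 0 < 1 / d := by positivity
  have hb : S / m * (1 / r) ≤ 3 * (1 / r) + 1 / m := by
    calc S / m * (1 / r) ≤ (3 + r / m) * (1 / r) := by gcongr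
      _ = _ := by field_simp
  have hSm0 : 0 ≤ S / m := by positivity
  have t1 : 8 * m * d * S / (m ^ 2 * d ^ 2) ≤ 8 * (3 * (1 / r) + 1 / m) := by
    calc 8 * m * d * S / (m ^ 2 * d ^ 2) = 8 * (S / m * (1 / d)) := by field_simp
      _ ≤ 8 * (S / m * (1 / r)) := by gcongr
      _ ≤ _ := by linarith
  have t2 : 60 * (P * S) / (m ^ 2 * d ^ 2) ≤ 60 * (3 * (1 / r) + 1 / m) := by
    calc 60 * (P * S) / (m ^ 2 * d ^ 2) = 60 * (S / m * (1 / r)) * ((r * P) / (m * d ^ 2)) := by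
          field_simp
      _ ≤ 60 * (S / m * (1 / r)) * 1 := by
          gcongr
          rw [div_le_one (by positivity)]
          exact hPd
      _ ≤ _ := by linarith
  have t3 : 60 * S ^ 2 / (m ^ 2 * d ^ 2) ≤ 360 * (1 / r) + 60 * (1 / m) := by
    have e : 60 * S ^ 2 / (m ^ 2 * d ^ 2) = 360 * (1 / d) ^ 2 + 60 * ((r / d) ^ 2 * (1 / m) ^ 2) := by
      rw [hS]; field_simp; ring
    have hrd1 : r / d ≤ 1 := by rw [div_le_one hd0]; exact hrd
    have e1 : (r / d) ^ 2 ≤ 1 := pow_le_one₀ (by positivity) hrd1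
    have e2 : (1 / m) ^ 2 ≤ 1 / m := by nlinarith
    have e3 : (1 / d) ^ 2 ≤ 1 / r := by nlinarith
    have e4 : (r / d) ^ 2 * (1 / m) ^ 2 ≤ 1 * (1 / m) := by gcongr
    rw [e]
    linarith
  have : (8 * m * d * S + 60 * (P * S + S ^ 2)) / (m ^ 2 * d ^ 2)
      = 8 * m * d * S / (m ^ 2 * d ^ 2) + 60 * (P * S) / (m ^ 2 * d ^ 2)
        + 60 * S ^ 2 / (m ^ 2 * d ^ 2) := by ring
  rw [this]
  linarith

lemma snr_facts {p n : ℕ} {σ Δ D : ℝ} (hn : 0 < n) (hσ : 0 < σ) (hΔ : 0 < Δ) (hD : Δ ≤ D)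
    (hr : 1 ≤ snr p n σ Δ) :
    snr p n σ Δ ≤ D / σ ∧ snr p n σ Δ * √(p : ℝ) ≤ √(n : ℝ) * (D / σ) ^ 2 := by
  set r := snr p n σ Δ with hrdef
  have hn' : (0 : ℝ) < n := by exact_mod_cast hn
  have hs : 0 < Δ ^ 2 / σ ^ 2 := by positivity
  set s := Δ ^ 2 / σ ^ 2 with hsdef
  have hq : 0 ≤ (p : ℝ) / n := by positivity
  have hsd : s ≤ (D / σ) ^ 2 := by
    rw [hsdef, ← div_pow]
    gcongr
  have hr2 : r ^ 2 * (s + (p : ℝ) / n) = s ^ 2 := by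
    rw [hrdef, snr, div_pow, Real.sq_sqrt (by positivity), ← hsdef]
    exact div_mul_cancel₀ _ (by positivity)
  have h1 : r ^ 2 ≤ s := by
    have : r ^ 2 * s ≤ s * s := by nlinarith [mul_nonneg (sq_nonneg r) hq]
    exact le_of_mul_le_mul_right this hs
  have hD0 : 0 < D := by linarith
  constructor
  · exact abs_le_of_sq_le_sq' (by linarith) (by positivity) |>.2
  · apply (abs_le_of_sq_le_sq' ?_ (by positivity)).2
    rw [mul_pow, mul_pow, Real.sq_sqrt (by positivity), Real.sq_sqrt (by positivity)]
    have h2 : r ^ 2 * ((p : ℝ) / n) ≤ s ^ 2 := by nlinarith [mul_nonneg (sq_nonneg r) hs.le]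
    have h3 : s ^ 2 ≤ ((D / σ) ^ 2) ^ 2 := by gcongr
    calc r ^ 2 * (p : ℝ) = n * (r ^ 2 * ((p : ℝ) / n)) := by field_simp
      _ ≤ _ := by gcongr; linarith

lemma num_final {p n : ℕ} {σ Δ D : ℝ} (hn : 0 < n) (hσ : 0 < σ) (hΔ : 0 < Δ) (hD : Δ ≤ D)
    (hr : 1 ≤ snr p n σ Δ) (L : ℝ) (hL : L = 6 * n + snr p n σ Δ ^ 2) :
    16 * ((4 * σ * √(n : ℝ) * (2 * D * √L)
          + 3 * σ ^ 2 * (20 * (√(p * L) + L))) / (n * D ^ 2)) ^ 2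
      ≤ 11520000 * (1 / snr p n σ Δ ^ 2 + 1 / n) := by
  obtain ⟨h1, h2⟩ := snr_facts hn hσ hΔ hD hr
  set r := snr p n σ Δ
  have hn1 : (1 : ℝ) ≤ n := by exact_mod_cast hn
  have hm : 1 ≤ √(n : ℝ) := Real.one_le_sqrt.2 hn1
  have hmsq : √(n : ℝ) ^ 2 = n := Real.sq_sqrt (by positivity)
  have hL0 : 0 ≤ L := by rw [hL]; positivity
  have hSsq : √L ^ 2 = L := Real.sq_sqrt hL0
  have hD0 : 0 < D := by linarith
  have key := num_aux (P := √(p : ℝ)) (S := √L) hm (Real.sqrt_nonneg _) (Real.sqrt_nonneg _)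
    (by rw [hSsq, hmsq, hL]) hr h1 h2
  have e : (4 * σ * √(n : ℝ) * (2 * D * √L)
          + 3 * σ ^ 2 * (20 * (√(p * L) + L))) / (n * D ^ 2)
      = (8 * √(n : ℝ) * (D / σ) * √L + 60 * (√(p : ℝ) * √L + √L ^ 2))
        / (√(n : ℝ) ^ 2 * (D / σ) ^ 2) := by
    rw [Real.sqrt_mul (by positivity), hSsq, hmsq]
    field_simp
    ring
  rw [e]
  set ρ := (8 * √(n : ℝ) * (D / σ) * √L + 60 * (√(p : ℝ) * √L + √L ^ 2))
        / (√(n : ℝ) ^ 2 * (D / σ) ^ 2) with hρ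
  have hρ0 : 0 ≤ ρ := by positivity
  have h3 : ρ ^ 2 ≤ (600 * (1 / r + 1 / √(n : ℝ))) ^ 2 := by gcongr
  have h4 : (1 / √(n : ℝ)) ^ 2 = 1 / n := by rw [div_pow, hmsq, one_pow]
  have h5 : (1 / r) ^ 2 = 1 / r ^ 2 := by rw [div_pow, one_pow]
  rw [← h4, ← h5]
  nlinarith [sq_nonneg (1 / r - 1 / √(n : ℝ))]

lemma prob_bound {p n : ℕ} {σ Δ : ℝ} (hp : 1 ≤ p) (hn : 0 < n) (hσ : 0 < σ) (hΔ : 0 < Δ)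
    (hr : 1 ≤ snr p n σ Δ) (hlog : 11520000 ≤ Real.log n)
    (f : (Fin p → Fin n → ℝ) → Fin n → ℝ) (hf : IsSpectralEstimator p n f)
    (θ : Fin p → ℝ) (η : Fin n → ℝ) (hθ : Δ ≤ eucNorm θ) (hη : η ∈ pmOne n) :
    ((lawY p n σ θ η) {y | (n : ℝ)⁻¹ * |∑ a, η a * f y a|
                  ≤ 1 - Real.log n / n - 11520001 / snr p n σ Δ ^ 2}).toReal
      ≤ 7 * 25 ^ n * Real.exp (-(6 * n + snr p n σ Δ ^ 2)) := by
  obtain ⟨hfm, v, hvm, hv, hfv⟩ := hf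
  have hD : 0 < eucNorm θ := by linarith
  obtain ⟨B, hB, hgood⟩ := core hp hn θ hD (6 * n + snr p n σ Δ ^ 2) σ (by positivity) hσ η hη
  have hnum := num_final (p := p) hn hσ hΔ hθ hr _ rfl
  refine le_trans ?_ hB
  have hfa : ∀ a, Measurable fun y => f y a := fun a => (measurable_pi_apply a).comp hfm
  have hms : MeasurableSet {y | (n : ℝ)⁻¹ * |∑ a, η a * f y a|
                  ≤ 1 - Real.log n / n - 11520001 / snr p n σ Δ ^ 2} := by
    apply measurableSet_le _ measurable_const
    have : Measurable fun y => ∑ a, η a * f y a :=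
      Finset.measurable_sum _ fun a _ => (hfa a).const_mul _
    exact (this.abs).const_mul _
  have hfin : IsFiniteMeasure (stdW p n) := by unfold stdW; infer_instance
  rw [lawY_eq, Measure.map_apply (by fun_prop) hms]
  refine measureReal_mono (fun w hw => ?_) (measure_ne_top _ _)
  by_contra hwB
  have h1 := hgood w hwB _ (hv _)
  have h2 : (n : ℝ)⁻¹ * |∑ a, η a * f (fun i a => θ i * η a + σ * w i a) a|
      ≤ 1 - Real.log n / n - 11520001 / snr p n σ Δ ^ 2 := hw
  simp only [hfv] at h2
  have hn' : (0 : ℝ) < n := by exact_mod_cast hn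
  have h3 : 11520000 * (1 / (n : ℝ)) ≤ Real.log n / n := by
    rw [mul_one_div]
    gcongr
  have h4 : 0 < 1 / snr p n σ Δ ^ 2 := by positivity
  have h5 : 11520001 / snr p n σ Δ ^ 2 = 11520001 * (1 / snr p n σ Δ ^ 2) := by ring
  linarith

lemma Phic_pos {t : ℝ} (ht : 0 ≤ t) : 0 < Phic t :=
  lt_of_lt_of_le (by positivity) (Phic_lower ht)

lemma base_lt : 25 * Real.exp (-6) < 1 := by
  have h1 : (2 : ℝ) ≤ Real.exp 1 := by linarith [Real.add_one_le_exp (1 : ℝ)]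
  have h2 : Real.exp 6 = Real.exp 1 ^ 6 := by rw [← Real.exp_nat_mul]; norm_num
  have h3 : (2 : ℝ) ^ 6 ≤ Real.exp 1 ^ 6 := by gcongr
  rw [Real.exp_neg, mul_inv_lt_iff₀ (Real.exp_pos _), h2]
  linarith

/-- Theorem 3 (bound in probability) for the spectral estimator. -/
theorem statement6 :
    ∃ C C' : ℝ, 0 < C ∧ 0 < C' ∧ ∀ (p : ℕ → ℕ) (σ Δ : ℕ → ℝ),
      (∀ n, 1 ≤ p n) → (∀ n, 0 < σ n) → (∀ n, 0 < Δ n) →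
      (∀ n, C ≤ snr (p n) n (σ n) (Δ n)) →
      ∃ ε : ℕ → ℝ, Tendsto ε atTop (nhds 0) ∧
        ∀ n, ∀ f : (Fin (p n) → Fin n → ℝ) → Fin n → ℝ, IsSpectralEstimator (p n) n f →
          (⨆ x : Omega (p n) n (Δ n),
            ((lawY (p n) n (σ n) x.1.1 x.1.2)
              {y | (n : ℝ)⁻¹ * |∑ a, x.1.2 a * f y a|
                  ≤ 1 - Real.log n / n - C' / snr (p n) n (σ n) (Δ n) ^ 2}).toReal)
            ≤ ε n * Phic (snr (p n) n (σ n) (Δ n)) := by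
  refine ⟨1, 11520001, by norm_num, by norm_num, ?_⟩
  intro p σ Δ hp hσ hΔ hr
  classical
  have hφ : ∀ n, 0 < Phic (snr (p n) n (σ n) (Δ n)) := fun n => Phic_pos (by linarith [hr n])
  let K : ℝ := 7 * (√(2 * Real.pi) * Real.exp 1)
  refine ⟨fun n => if 11520000 ≤ Real.log n then K * (25 * Real.exp (-6)) ^ n
    else (Phic (snr (p n) n (σ n) (Δ n)))⁻¹, ?_, ?_⟩
  · have h1 : Tendsto (fun n : ℕ => K * (25 * Real.exp (-6)) ^ n) atTop (nhds 0) := by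
      have := (tendsto_pow_atTop_nhds_zero_of_lt_one (by positivity) base_lt).const_mul K
      simpa using this
    refine h1.congr' ?_
    have h2 : ∀ᶠ n : ℕ in atTop, 11520000 ≤ Real.log n :=
      (Real.tendsto_log_atTop.comp tendsto_natCast_atTop_atTop).eventually_ge_atTop _
    filter_upwards [h2] with n hn
    rw [if_pos hn]
  · intro n f hf
    dsimp only
    split_ifs with h
    · have hn : 0 < n := by
        rcases Nat.eq_zero_or_pos n with h0 | h0
        · subst h0; norm_num at h
        · exact h0
      refine Real.iSup_le (fun x => ?_) (mul_nonneg (by positivity) (hφ n).le)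
      refine (prob_bound (hp n) hn (hσ n) (hΔ n) (hr n) h f hf _ _ x.2.1 x.2.2).trans ?_
      have hl := Phic_lower (t := snr (p n) n (σ n) (Δ n)) (by linarith [hr n])
      set r := snr (p n) n (σ n) (Δ n)
      calc 7 * 25 ^ n * Real.exp (-(6 * n + r ^ 2))
          = K * (25 * Real.exp (-6)) ^ n *
            ((√(2 * Real.pi))⁻¹ * Real.exp (-1) * Real.exp (-r ^ 2)) := by
            have e1 : Real.exp (-(6 * n + r ^ 2)) = Real.exp (-6) ^ n * Real.exp (-r ^ 2) := by
              rw [← Real.exp_nat_mul, ← Real.exp_add]; congr 1; ring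
            have e2 : Real.exp 1 * Real.exp (-1) = 1 := by rw [← Real.exp_add]; simp
            have e3 : √(2 * Real.pi) * (√(2 * Real.pi))⁻¹ = 1 :=
              mul_inv_cancel₀ (by positivity)
            rw [e1, mul_pow]
            calc 7 * 25 ^ n * (Real.exp (-6) ^ n * Real.exp (-r ^ 2))
                = 7 * 25 ^ n * (Real.exp (-6) ^ n * Real.exp (-r ^ 2))
                  * (√(2 * Real.pi) * (√(2 * Real.pi))⁻¹) * (Real.exp 1 * Real.exp (-1)) := by
                  rw [e2, e3]; ring
              _ = _ := by simp only [K]; ring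
        _ ≤ _ := by gcongr
    · rw [inv_mul_cancel₀ (hφ n).ne']
      refine Real.iSup_le (fun x => ?_) zero_le_one
      have : IsProbabilityMeasure (lawY (p n) n (σ n) x.1.1 x.1.2) := by
        unfold lawY; infer_instance
      exact measureReal_le_one

end
end
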